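/- Let F be a forest with labelling λ, and let e be an edge of F such that some leaf vertex u ∉ e is adjacent to an endpoint of e. Then BD^λ(F) is homotopy equivalent to the wedge of BD^λ(F \ e) with the suspension of BD^{λ_e}(F \ e), where λ_e lowers the labels of the two endpoints of e by 1. Consequently, the number of d-dimensional spheres in the wedge decomposition satisfies (F,λ)_d = (F\e, λ)_d + (F\e, λ_e)_{d−1}. -/

import Mathlib

open Finset

/-- Degree of a vertex `v` in a finite set `H` of edges. -/
def edgeDeg {V : Type*} [DecidableEq V] (H : Finset (Sym2 V)) (v : V) : ℕ :=
  (H.filter (fun e => v ∈ e)).card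

/-- The bounded degree complex `BD^λ(G)`: its faces are the finite sets `H` of edges of `G`
such that every vertex `v` lies on at most `lam v` edges of `H`. -/
def BD {V : Type*} [DecidableEq V] (G : SimpleGraph V) (lam : V → ℕ) :
    Set (Finset (Sym2 V)) :=
  {H | ↑H ⊆ G.edgeSet ∧ ∀ v, edgeDeg H v ≤ lam v}

/-- The link `(K : a)` of the vertex `a` in `K`. -/
def linkC {α : Type*} [DecidableEq α] (K : Set (Finset α)) (a : α) : Set (Finset α) :=
  {τ | τ ∈ K ∧ a ∉ τ ∧ insert a τ ∈ K}

/-- The face-deletion `(K, a)` of the vertex `a` in `K`. -/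
def delC {α : Type*} [DecidableEq α] (K : Set (Finset α)) (a : α) : Set (Finset α) :=
  {τ | τ ∈ K ∧ a ∉ τ}

/-- The suspension `Σ K = K ∗ {∅, {x}, {y}}` with two new suspension vertices
`Sum.inr 0` and `Sum.inr 1`. -/
def suspC {α : Type*} [DecidableEq α] (K : Set (Finset α)) : Set (Finset (α ⊕ Fin 2)) :=
  {σ | ∃ τ ∈ K, ∃ s ∈ ({∅, {Sum.inr 0}, {Sum.inr 1}} : Set (Finset (α ⊕ Fin 2))),
    σ = τ.image Sum.inl ∪ s}

/-- Geometric realization of a complex on a finite vertex type, as the subspace of `α → ℝ`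
of convex-coefficient vectors whose support is contained in a face. -/
def realization {α : Type*} [Fintype α] (K : Set (Finset α)) : Set (α → ℝ) :=
  {x | (∀ a, 0 ≤ x a) ∧ (∑ a, x a) = 1 ∧ ∃ σ ∈ K, ∀ a, x a ≠ 0 → a ∈ σ}

/-- A base point of the `d`-dimensional unit sphere. -/
noncomputable def spherePt (d : ℕ) : (Metric.sphere (0 : EuclideanSpace ℝ (Fin (d+1))) 1) :=
  ⟨EuclideanSpace.single 0 1, by simp⟩

/-- Wedge of spheres: one `d i`-dimensional sphere for each `i : ι`, with all base points glued
together (to an extra point, so that the empty wedge is a single point). -/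
def WedgeOfSpheres (ι : Type*) (d : ι → ℕ) : Type _ :=
  Quot (fun x y : Unit ⊕ (Σ i : ι, Metric.sphere (0 : EuclideanSpace ℝ (Fin (d i + 1))) 1) =>
    (x = Sum.inl () ∨ ∃ i, x = Sum.inr ⟨i, spherePt (d i)⟩) ∧
    (y = Sum.inl () ∨ ∃ i, y = Sum.inr ⟨i, spherePt (d i)⟩))

noncomputable instance (ι : Type*) (d : ι → ℕ) : TopologicalSpace (WedgeOfSpheres ι d) := by
  unfold WedgeOfSpheres; infer_instance

/-- The wedge (one point union) of two pointed spaces. -/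
def wedgeTwo (X Y : Type*) [TopologicalSpace X] [TopologicalSpace Y] (x₀ : X) (y₀ : Y) :
    Type _ :=
  Quot (fun a b : X ⊕ Y =>
    (a = Sum.inl x₀ ∨ a = Sum.inr y₀) ∧ (b = Sum.inl x₀ ∨ b = Sum.inr y₀))

instance (X Y : Type*) [TopologicalSpace X] [TopologicalSpace Y] (x₀ : X) (y₀ : Y) :
    TopologicalSpace (wedgeTwo X Y x₀ y₀) := by
  unfold wedgeTwo; infer_instance

section

open ContinuousMap Topology

/-! ### Maps that are homotopy equivalences -/

/-- A continuous map with a homotopy inverse. -/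
def IsHtpyEquiv {X Y : Type*} [TopologicalSpace X] [TopologicalSpace Y] (f : C(X, Y)) : Prop :=
  ∃ g : C(Y, X), (g.comp f).Homotopic (ContinuousMap.id X) ∧
    (f.comp g).Homotopic (ContinuousMap.id Y)

section HtpyEquiv

variable {X Y Z W : Type*} [TopologicalSpace X] [TopologicalSpace Y] [TopologicalSpace Z]
  [TopologicalSpace W]

theorem IsHtpyEquiv.nonempty {f : C(X, Y)} (h : IsHtpyEquiv f) :
    Nonempty (ContinuousMap.HomotopyEquiv X Y) := by
  obtain ⟨g, h₁, h₂⟩ := h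
  exact ⟨⟨f, g, h₁, h₂⟩⟩

theorem IsHtpyEquiv.congr {f g : C(X, Y)} (h : IsHtpyEquiv f) (hfg : f.Homotopic g) :
    IsHtpyEquiv g := by
  obtain ⟨k, h₁, h₂⟩ := h
  exact ⟨k, (((Homotopic.refl k).comp hfg).symm).trans h₁,
    ((hfg.comp (Homotopic.refl k)).symm).trans h₂⟩

theorem IsHtpyEquiv.of_left_right {f : C(X, Y)} {l r : C(Y, X)}
    (hl : (l.comp f).Homotopic (ContinuousMap.id X))
    (hr : (f.comp r).Homotopic (ContinuousMap.id Y)) : IsHtpyEquiv f := by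
  refine ⟨l, hl, ?_⟩
  have h : l.Homotopic r := by
    have h₁ : (l.comp (f.comp r)).Homotopic l := (Homotopic.refl l).comp hr
    have h₂ : ((l.comp f).comp r).Homotopic r := hl.comp (Homotopic.refl r)
    exact h₁.symm.trans h₂
  exact ((Homotopic.refl f).comp h).trans hr

/-- The middle case of the two-out-of-six property. -/
theorem IsHtpyEquiv.of_comp_comp {f : C(X, Y)} {g : C(Y, Z)} {h : C(Z, W)}
    (hgf : IsHtpyEquiv (g.comp f)) (hhg : IsHtpyEquiv (h.comp g)) : IsHtpyEquiv f := by
  obtain ⟨a, a₁, a₂⟩ := hgf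
  obtain ⟨b, b₁, b₂⟩ := hhg
  -- `g` has right inverse `f ∘ a` and left inverse `b ∘ h`
  obtain ⟨c, c₁, c₂⟩ : IsHtpyEquiv g :=
    IsHtpyEquiv.of_left_right (l := b.comp h) (r := f.comp a) b₁ a₂
  refine ⟨a.comp g, a₁, ?_⟩
  have e₁ : ((c.comp g).comp (f.comp (a.comp g))).Homotopic (f.comp (a.comp g)) :=
    c₁.comp (Homotopic.refl (f.comp (a.comp g)))
  have e₂ : (c.comp (((g.comp f).comp a).comp g)).Homotopic (c.comp g) :=
    (Homotopic.refl c).comp (a₂.comp (Homotopic.refl g))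
  exact e₁.symm.trans (e₂.trans c₁)

end HtpyEquiv

/-! ### Mapping cones -/

/-- The gluing relation of the mapping cone, whose cone coordinate is an arbitrary real number
that only matters between `0` and `1`. -/
inductive ConeRel {L D : Type*} (φ : L → D) : D ⊕ (L × ℝ) ⊕ Unit → D ⊕ (L × ℝ) ⊕ Unit → Prop
  | base (l : L) (t : ℝ) (ht : t ≤ 0) : ConeRel φ (Sum.inr (Sum.inl (l, t))) (Sum.inl (φ l))
  | apex (l : L) (t : ℝ) (ht : 1 ≤ t) :
      ConeRel φ (Sum.inr (Sum.inl (l, t))) (Sum.inr (Sum.inr ()))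

/-- The mapping cone of a map. -/
def MCone {L D : Type*} (φ : L → D) : Type _ := Quot (ConeRel φ)

namespace MCone

variable {L D L' D' Z : Type*} [TopologicalSpace L] [TopologicalSpace D] [TopologicalSpace L']
  [TopologicalSpace D'] [TopologicalSpace Z]

instance (φ : L → D) : TopologicalSpace (MCone φ) :=
  inferInstanceAs (TopologicalSpace (Quot (ConeRel φ)))

/-- The inclusion of the target. -/
def incl (φ : L → D) : C(D, MCone φ) :=
  ⟨fun d => Quot.mk _ (Sum.inl d), continuous_quot_mk.comp continuous_inl⟩

/-- The parametrization of the cone. -/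
def cyl (φ : L → D) : C(L × ℝ, MCone φ) :=
  ⟨fun p => Quot.mk _ (Sum.inr (Sum.inl p)),
    continuous_quot_mk.comp (continuous_inr.comp continuous_inl)⟩

/-- The cone point. -/
def apex (φ : L → D) : MCone φ := Quot.mk _ (Sum.inr (Sum.inr ()))

theorem cyl_of_le {φ : L → D} (l : L) {t : ℝ} (ht : t ≤ 0) : cyl φ (l, t) = incl φ (φ l) :=
  Quot.sound (ConeRel.base l t ht)

theorem cyl_of_ge {φ : L → D} (l : L) {t : ℝ} (ht : 1 ≤ t) : cyl φ (l, t) = apex φ :=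
  Quot.sound (ConeRel.apex l t ht)

theorem ind {φ : L → D} {P : MCone φ → Prop} (h₁ : ∀ d, P (incl φ d))
    (h₂ : ∀ l t, P (cyl φ (l, t))) (h₃ : P (apex φ)) (c : MCone φ) : P c := by
  induction c using Quot.ind with
  | mk a =>
    rcases a with d | ⟨l, t⟩ | ⟨⟩
    · exact h₁ d
    · exact h₂ l t
    · exact h₃

theorem ind_Ioo {φ : L → D} {P : MCone φ → Prop} (h₁ : ∀ d, P (incl φ d))
    (h₂ : ∀ l t, 0 < t → t < 1 → P (cyl φ (l, t))) (h₃ : P (apex φ)) (c : MCone φ) : P c := by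
  refine ind h₁ (fun l t => ?_) h₃ c
  rcases le_or_gt t 0 with h | h
  · rw [cyl_of_le l h]; exact h₁ _
  · rcases le_or_gt 1 t with h' | h'
    · rw [cyl_of_ge l h']; exact h₃
    · exact h₂ l t h h'

/-- Maps out of a mapping cone. -/
def desc {φ : L → D} (f : C(D, Z)) (k : C(L × ℝ, Z)) (z : Z)
    (h₀ : ∀ l t, t ≤ 0 → k (l, t) = f (φ l)) (h₁ : ∀ l t, 1 ≤ t → k (l, t) = z) :
    C(MCone φ, Z) :=
  ⟨Quot.lift (Sum.elim f (Sum.elim k fun _ => z)) (by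
      rintro _ _ (⟨l, t, ht⟩ | ⟨l, t, ht⟩)
      · exact h₀ l t ht
      · exact h₁ l t ht),
    continuous_quot_lift _ (f.continuous.sumElim (k.continuous.sumElim continuous_const))⟩

section desc

variable {φ : L → D} (f : C(D, Z)) (k : C(L × ℝ, Z)) (z : Z)
    (h₀ : ∀ l t, t ≤ 0 → k (l, t) = f (φ l)) (h₁ : ∀ l t, 1 ≤ t → k (l, t) = z)

end desc

/-- Homotopies between maps out of a mapping cone can be described on the two pieces. -/
theorem homotopic_of {φ : L → D} {f g : C(MCone φ, Z)} (F : C(D × unitInterval, Z))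
    (K : C((L × ℝ) × unitInterval, Z)) (z : C(unitInterval, Z))
    (h₀ : ∀ l t s, t ≤ 0 → K ((l, t), s) = F (φ l, s)) (h₁ : ∀ l t s, 1 ≤ t → K ((l, t), s) = z s)
    (F₀ : ∀ d, F (d, 0) = f (incl φ d)) (F₁ : ∀ d, F (d, 1) = g (incl φ d))
    (K₀ : ∀ l t, 0 < t → t < 1 → K ((l, t), 0) = f (cyl φ (l, t)))
    (K₁ : ∀ l t, 0 < t → t < 1 → K ((l, t), 1) = g (cyl φ (l, t)))
    (z₀ : z 0 = f (apex φ)) (z₁ : z 1 = g (apex φ)) : f.Homotopic g := by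
  let H : C(MCone φ, C(unitInterval, Z)) := desc F.curry K.curry z
    (fun l t ht => by ext s; exact h₀ l t s ht) (fun l t ht => by ext s; exact h₁ l t s ht)
  refine ⟨⟨⟨fun p => H p.2 p.1, ?_⟩, ?_, ?_⟩⟩
  · exact (ContinuousMap.continuous_uncurry_of_continuous H).comp continuous_swap
  · intro c
    exact ind_Ioo (P := fun c => H c 0 = f c) F₀ K₀ z₀ c
  · intro c
    exact ind_Ioo (P := fun c => H c 1 = g c) F₁ K₁ z₁ c

/-- The map of mapping cones induced by a map of the targets. -/
def push (φ : L → D) (g : C(D, D')) : C(MCone φ, MCone (g ∘ φ)) :=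
  desc ((incl _).comp g) (cyl _) (apex _) (fun l _ ht => cyl_of_le l ht)
    (fun l _ ht => cyl_of_ge l ht)

theorem push_comp {D'' : Type*} [TopologicalSpace D''] (φ : L → D) (g : C(D, D'))
    (k : C(D', D'')) : (push (g ∘ φ) k).comp (push φ g) = push φ (k.comp g) := by
  ext c
  exact ind (P := fun c => push (g ∘ φ) k (push φ g c) = push φ (k.comp g) c)
    (fun _ => rfl) (fun _ _ => rfl) rfl c

/-- The path which first runs back along the homotopy `N` and then up the cone. -/
noncomputable def slide {φ ψ : C(L, D)} (N : φ.Homotopy ψ) : C(L × ℝ, MCone φ) :=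
  ⟨fun p => if p.2 ≤ 0 then incl φ (N.extend (-p.2) p.1) else cyl φ p, by
    refine Continuous.if_le ?_ (cyl φ).continuous continuous_snd continuous_const ?_
    · exact (incl φ).continuous.comp (N.continuous.comp
        ((continuous_projIcc.comp continuous_snd.neg).prodMk continuous_fst))
    · rintro ⟨l, t⟩ (rfl : t = 0)
      rw [cyl_of_le l le_rfl]
      simp⟩

theorem slide_of_le {φ ψ : C(L, D)} (N : φ.Homotopy ψ) (l : L) {t : ℝ} (ht : t ≤ 0) :
    slide N (l, t) = incl φ (N.extend (-t) l) := if_pos ht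

theorem slide_of_ge {φ ψ : C(L, D)} (N : φ.Homotopy ψ) (l : L) {t : ℝ} (ht : 0 ≤ t) :
    slide N (l, t) = cyl φ (l, t) := by
  rcases ht.eq_or_lt with rfl | h
  · rw [slide_of_le N l le_rfl, cyl_of_le l le_rfl]; simp
  · exact if_neg (not_le.mpr h)

/-- The comparison of the mapping cones of homotopic maps. -/
noncomputable def transfer {φ ψ : C(L, D)} (N : φ.Homotopy ψ) : C(MCone ψ, MCone φ) :=
  desc (incl _) ((slide N).comp ⟨fun p => (p.1, 2 * p.2 - 1), by fun_prop⟩) (apex _)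
    (fun l t ht => by
      simp only [ContinuousMap.comp_apply, ContinuousMap.coe_mk]
      rw [slide_of_le N l (by linarith), N.extend_apply_of_one_le (by linarith)])
    (fun l t ht => by
      simp only [ContinuousMap.comp_apply, ContinuousMap.coe_mk]
      rw [slide_of_ge N l (by linarith), cyl_of_ge l (by linarith)])

theorem transfer_comp_symm {φ ψ : C(L, D)} (N : φ.Homotopy ψ) :
    ((transfer N).comp (transfer N.symm)).Homotopic (ContinuousMap.id _) := by
  refine Homotopic.symm (homotopic_of ((incl φ).comp ⟨Prod.fst, continuous_fst⟩)
    ((slide N).comp ⟨fun p => (p.1.1, (1 - (p.2 : ℝ)) * min 1 (max 0 p.1.2)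
      + p.2 * max (-2 * max 0 p.1.2) (4 * min 1 p.1.2 - 3)), by fun_prop⟩)
    (ContinuousMap.const _ (apex _)) ?_ ?_ (fun _ => rfl) (fun _ => rfl) ?_ ?_ rfl rfl)
  · intro l t s ht
    have h : max (-2 * max 0 t) (4 * min 1 t - 3) = 0 := by
      rw [max_eq_left ht, min_eq_right (by linarith), max_eq_left] <;> linarith
    simp only [ContinuousMap.comp_apply, ContinuousMap.coe_mk, h]
    rw [max_eq_left ht, min_eq_right zero_le_one, slide_of_le N l (by simp)]
    simp
  · intro l t s ht
    have h : max (-2 * max 0 t) (4 * min 1 t - 3) = 1 := by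
      rw [max_eq_right (by linarith : 0 ≤ t), min_eq_left ht, max_eq_right] <;> linarith
    simp only [ContinuousMap.comp_apply, ContinuousMap.coe_mk, h]
    rw [max_eq_right (by linarith), min_eq_left ht, slide_of_ge N l (by norm_num),
      cyl_of_ge l (by norm_num)]
    rfl
  · intro l t h0 h1
    simp only [ContinuousMap.comp_apply, ContinuousMap.coe_mk]
    rw [max_eq_right h0.le, min_eq_right h1.le]
    simp only [Set.Icc.coe_zero, sub_zero, one_mul, zero_mul, add_zero]
    rw [slide_of_ge N l h0.le]; rfl
  · intro l t h0 h1
    simp only [ContinuousMap.comp_apply, ContinuousMap.coe_mk]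
    rw [max_eq_right h0.le, min_eq_right h1.le]
    simp only [Set.Icc.coe_one, sub_self, one_mul, zero_mul, zero_add]
    change _ = transfer N (slide N.symm (l, 2 * t - 1))
    rcases le_total (2 * t - 1) 0 with h | h
    · rw [slide_of_le _ l h, max_eq_left (by linarith), slide_of_le _ l (by linarith)]
      change _ = incl φ _
      rw [N.symm.extend_apply_of_mem_I ⟨by linarith, by linarith⟩,
        N.extend_apply_of_mem_I ⟨by linarith, by linarith⟩]
      congr 1
      change _ = N (unitInterval.symm _, l)
      congr 2
      ext
      simp
    · rw [slide_of_ge _ l h, max_eq_right (by linarith)]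
      change _ = slide N (l, 2 * (2 * t - 1) - 1)
      congr 2
      ring

theorem isHtpyEquiv_transfer {φ ψ : C(L, D)} (N : φ.Homotopy ψ) : IsHtpyEquiv (transfer N) := by
  refine ⟨transfer N.symm, ?_, transfer_comp_symm N⟩
  have := transfer_comp_symm N.symm
  rwa [Homotopy.symm_symm] at this

theorem isHtpyEquiv_push_of_homotopic_id (φ : C(L, D)) (m : C(D, D))
    (hm : m.Homotopic (ContinuousMap.id D)) : IsHtpyEquiv (push φ m) := by
  obtain ⟨H⟩ := hm
  let N : (m.comp φ).Homotopy φ := H.compContinuousMap φ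
  have hN : ∀ s l, N (s, l) = H (s, φ l) := fun _ _ => rfl
  refine (isHtpyEquiv_transfer N).congr (Homotopic.symm (homotopic_of
    ((incl (m.comp φ)).comp ⟨fun p => H (p.2, p.1), by fun_prop⟩)
    ((slide N).comp ⟨fun p => (p.1.1, (1 + (p.2 : ℝ)) * max 0 p.1.2 - p.2), by fun_prop⟩)
    (ContinuousMap.const _ (apex _)) ?_ ?_ (fun d => ?_) (fun d => ?_) ?_ ?_ rfl rfl))
  · intro l t s ht
    simp only [ContinuousMap.comp_apply, ContinuousMap.coe_mk]
    rw [max_eq_left ht, slide_of_le N l (by have := s.2.1; linarith)]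
    rw [N.extend_apply_of_mem_I ⟨by have := s.2.1; linarith, by have := s.2.2; linarith⟩]
    rw [hN]
    congr 4
    simp
  · intro l t s ht
    have hs := s.2.1
    simp only [ContinuousMap.comp_apply, ContinuousMap.coe_mk]
    rw [max_eq_right (by linarith), slide_of_ge N l (by nlinarith), cyl_of_ge l (by nlinarith)]
    rfl
  · change incl _ (H (0, d)) = _
    rw [H.apply_zero]; rfl
  · change incl _ (H (1, d)) = _
    rw [H.apply_one]; rfl
  · intro l t h0 h1
    simp only [ContinuousMap.comp_apply, ContinuousMap.coe_mk]
    rw [max_eq_right h0.le]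
    simp only [Set.Icc.coe_zero, sub_zero, one_mul, add_zero]
    rw [slide_of_ge N l h0.le]; rfl
  · intro l t h0 h1
    simp only [ContinuousMap.comp_apply, ContinuousMap.coe_mk]
    rw [max_eq_right h0.le]
    change _ = slide N (l, 2 * t - 1)
    simp only [Set.Icc.coe_one]
    congr 2
    ring

/-- The mapping cone is homotopy invariant in the target. -/
theorem isHtpyEquiv_push (φ : C(L, D)) {g : C(D, D')} (hg : IsHtpyEquiv g) :
    IsHtpyEquiv (push φ g) := by
  obtain ⟨k, h₁, h₂⟩ := hg
  refine IsHtpyEquiv.of_comp_comp (g := push (g ∘ φ) k) (h := push (k ∘ g ∘ φ) g) ?_ ?_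
  · rw [push_comp]
    exact isHtpyEquiv_push_of_homotopic_id φ (k.comp g) h₁
  · rw [push_comp (g ∘ φ) k g]
    exact isHtpyEquiv_push_of_homotopic_id (g.comp φ) (g.comp k) h₂

/-- The map between mapping cones of constant maps induced by a map of the sources. -/
def pull (x : D) (h : C(L, L')) : C(MCone (fun _ : L => x), MCone (fun _ : L' => x)) :=
  desc (incl _) ((cyl _).comp ⟨fun p => (h p.1, p.2), by fun_prop⟩) (apex _)
    (fun l _ ht => cyl_of_le (h l) ht) (fun l _ ht => cyl_of_ge (h l) ht)

theorem pull_homotopic (x : D) {h₀ h₁ : C(L, L')} (H : h₀.Homotopic h₁) :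
    (pull x h₀).Homotopic (pull x h₁) := by
  obtain ⟨H⟩ := H
  refine homotopic_of ((incl _).comp ⟨Prod.fst, continuous_fst⟩)
    ((cyl _).comp ⟨fun p => (H (p.2, p.1.1), p.1.2), by fun_prop⟩)
    (ContinuousMap.const _ (apex _)) (fun l t s ht => cyl_of_le _ ht)
    (fun l t s ht => cyl_of_ge _ ht) (fun _ => rfl) (fun _ => rfl) ?_ ?_ rfl rfl
  · intro l t _ _
    change cyl _ (H (0, l), t) = cyl _ (h₀ l, t)
    rw [H.apply_zero]
  · intro l t _ _
    change cyl _ (H (1, l), t) = cyl _ (h₁ l, t)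
    rw [H.apply_one]

theorem pull_id (x : D) : pull x (ContinuousMap.id L) = ContinuousMap.id _ := by
  ext c
  exact ind (P := fun c => pull x (ContinuousMap.id L) c = c) (fun _ => rfl) (fun _ _ => rfl) rfl c

theorem isHtpyEquiv_pull (x : D) {h : C(L, L')} (hh : IsHtpyEquiv h) :
    IsHtpyEquiv (pull x h) := by
  obtain ⟨k, h₁, h₂⟩ := hh
  refine ⟨pull x k, ?_, ?_⟩
  · have e : (pull x k).comp (pull x h) = pull x (k.comp h) := by
      ext c
      exact ind (P := fun c => pull x k (pull x h c) = pull x (k.comp h) c)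
        (fun _ => rfl) (fun _ _ => rfl) rfl c
    rw [e, ← pull_id]
    exact pull_homotopic x h₁
  · have e : (pull x h).comp (pull x k) = pull x (h.comp k) := by
      ext c
      exact ind (P := fun c => pull x h (pull x k c) = pull x (h.comp k) c)
        (fun _ => rfl) (fun _ _ => rfl) rfl c
    rw [e, ← pull_id]
    exact pull_homotopic x h₂

/-- Attaching the cone over a point does not change the homotopy type. -/
theorem isHtpyEquiv_incl_of_subsingleton [Subsingleton L] [Nonempty L] (x : D) :
    IsHtpyEquiv (incl (fun _ : L => x)) := by
  obtain ⟨l₀⟩ := ‹Nonempty L›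
  refine ⟨desc (ContinuousMap.id D) (ContinuousMap.const _ x) x (fun _ _ _ => rfl)
    (fun _ _ _ => rfl), Homotopic.refl _, ?_⟩
  refine homotopic_of ((incl _).comp ⟨Prod.fst, continuous_fst⟩)
    ((cyl _).comp ⟨fun p => (p.1.1, (p.2 : ℝ) * min 1 p.1.2), by fun_prop⟩)
    ((cyl _).comp ⟨fun s => (l₀, s), by fun_prop⟩) ?_ ?_ (fun _ => rfl) (fun _ => rfl) ?_ ?_ ?_ ?_
  · intro l t s ht
    refine cyl_of_le l (mul_nonpos_of_nonneg_of_nonpos s.2.1 (min_le_of_right_le ht))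
  · intro l t s ht
    change cyl _ (l, (s : ℝ) * min 1 t) = cyl _ (l₀, (s : ℝ))
    rw [min_eq_left ht, mul_one, Subsingleton.elim l l₀]
  · intro l t _ _
    exact cyl_of_le l (by simp)
  · intro l t _ h1
    change cyl _ (l, (1 : ℝ) * min 1 t) = cyl _ (l, t)
    rw [min_eq_right h1.le, one_mul]
  · exact cyl_of_le l₀ le_rfl
  · exact cyl_of_ge l₀ le_rfl

/-- Mapping cones of constant maps with values in the same path component. -/
theorem nonempty_homotopyEquiv_of_joined {x y : D} (h : Joined x y) :
    Nonempty (ContinuousMap.HomotopyEquiv (MCone (fun _ : L => x)) (MCone (fun _ : L => y))) := by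
  obtain ⟨p⟩ := h
  let N : (ContinuousMap.const L y).Homotopy (ContinuousMap.const L x) :=
    ⟨⟨fun q => p.symm q.1, by fun_prop⟩, fun _ => p.symm.source, fun _ => p.symm.target⟩
  exact (isHtpyEquiv_transfer N).nonempty

theorem compactSpace [CompactSpace L] [CompactSpace D] (φ : L → D) : CompactSpace (MCone φ) := by
  have h : (Set.univ : Set (MCone φ)) =
      Set.range (incl φ) ∪ cyl φ '' (Set.univ ×ˢ Set.Icc 0 1) ∪ {apex φ} := by
    refine (Set.eq_univ_of_forall fun c => ?_).symm
    refine ind_Ioo (fun d => ?_) (fun l t h0 h1 => ?_) ?_ c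
    · exact Or.inl (Or.inl ⟨d, rfl⟩)
    · exact Or.inl (Or.inr ⟨(l, t), ⟨trivial, h0.le, h1.le⟩, rfl⟩)
    · exact Or.inr rfl
  refine ⟨?_⟩
  rw [h]
  exact ((isCompact_range (incl φ).continuous).union
    ((isCompact_univ.prod isCompact_Icc).image (cyl φ).continuous)).union isCompact_singleton

end MCone

/-! ### Maps out of wedges of spheres -/

/-- The unit sphere of dimension `d`. -/
abbrev USphere (d : ℕ) : Type := Metric.sphere (0 : EuclideanSpace ℝ (Fin (d + 1))) 1

namespace WedgeOfSpheres

variable {ι : Type*} {d : ι → ℕ} {Z : Type*} [TopologicalSpace Z]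

/-- The wedge point. -/
def pt (ι : Type*) (d : ι → ℕ) : WedgeOfSpheres ι d := Quot.mk _ (Sum.inl ())

/-- The inclusion of a sphere in the wedge. -/
def sph (d : ι → ℕ) (i : ι) : C(USphere (d i), WedgeOfSpheres ι d) :=
  ⟨fun x => Quot.mk _ (Sum.inr ⟨i, x⟩),
    continuous_quot_mk.comp (continuous_inr.comp continuous_sigmaMk)⟩

theorem sph_spherePt (i : ι) : sph d i (spherePt (d i)) = pt ι d :=
  Quot.sound ⟨Or.inr ⟨i, rfl⟩, Or.inl rfl⟩

theorem ind {P : WedgeOfSpheres ι d → Prop} (h₀ : P (pt ι d)) (h₁ : ∀ i x, P (sph d i x))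
    (c : WedgeOfSpheres ι d) : P c := by
  induction c using Quot.ind with
  | mk a =>
    rcases a with ⟨⟩ | ⟨i, x⟩
    · exact h₀
    · exact h₁ i x

/-- Maps out of a wedge of spheres. -/
def desc (z : Z) (f : ∀ i, C(USphere (d i), Z)) (h : ∀ i, f i (spherePt (d i)) = z) :
    C(WedgeOfSpheres ι d, Z) :=
  ⟨Quot.lift (Sum.elim (fun _ => z) fun p => f p.1 p.2) (by
      have key : ∀ a : Unit ⊕ (Σ i : ι, USphere (d i)),
          (a = Sum.inl () ∨ ∃ i, a = Sum.inr ⟨i, spherePt (d i)⟩) →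
          (Sum.elim (fun _ => z) fun p : (Σ i : ι, USphere (d i)) => f p.1 p.2) a = z := by
        rintro _ (rfl | ⟨i, rfl⟩)
        · rfl
        · exact h i
      rintro a b ⟨ha, hb⟩
      rw [key a ha, key b hb]),
    continuous_quot_lift _ (continuous_const.sumElim
      (continuous_sigma fun i => (f i).continuous))⟩

theorem homotopic_of {f g : C(WedgeOfSpheres ι d, Z)} (z : C(unitInterval, Z))
    (F : ∀ i, C(USphere (d i) × unitInterval, Z)) (h : ∀ i s, F i (spherePt (d i), s) = z s)
    (z₀ : z 0 = f (pt ι d)) (z₁ : z 1 = g (pt ι d)) (F₀ : ∀ i x, F i (x, 0) = f (sph d i x))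
    (F₁ : ∀ i x, F i (x, 1) = g (sph d i x)) : f.Homotopic g := by
  let H : C(WedgeOfSpheres ι d, C(unitInterval, Z)) :=
    desc z (fun i => (F i).curry) (fun i => by ext s; exact h i s)
  refine ⟨⟨⟨fun p => H p.2 p.1, ?_⟩, ?_, ?_⟩⟩
  · exact (ContinuousMap.continuous_uncurry_of_continuous H).comp continuous_swap
  · intro c
    exact ind (P := fun c => H c 0 = f c) z₀ F₀ c
  · intro c
    exact ind (P := fun c => H c 1 = g c) z₁ F₁ c

/-- Maps out of the product of a wedge of spheres with a locally compact space. -/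
noncomputable def descProd {A : Type*} [TopologicalSpace A] [LocallyCompactSpace A] (z : C(A, Z))
    (f : ∀ i, C(USphere (d i) × A, Z)) (h : ∀ i a, f i (spherePt (d i), a) = z a) :
    C(WedgeOfSpheres ι d × A, Z) :=
  (desc z (fun i => (f i).curry) (fun i => by ext a; exact h i a)).uncurry

section descProd

variable {A : Type*} [TopologicalSpace A] [LocallyCompactSpace A] (z : C(A, Z))
    (f : ∀ i, C(USphere (d i) × A, Z)) (h : ∀ i a, f i (spherePt (d i), a) = z a)

end descProd

end WedgeOfSpheres

/-! ### Polar coordinates and the collapse of a ball onto a sphere -/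

section Polar

variable {d : ℕ}

/-- The direction of a vector. -/
noncomputable def direction (y : EuclideanSpace ℝ (Fin (d + 1))) : USphere d :=
  if h : y = 0 then spherePt d else ⟨‖y‖⁻¹ • y, by
    simp [norm_smul, inv_mul_cancel₀ (norm_ne_zero_iff.mpr h)]⟩

theorem direction_zero : direction (0 : EuclideanSpace ℝ (Fin (d + 1))) = spherePt d := dif_pos rfl

theorem coe_direction {y : EuclideanSpace ℝ (Fin (d + 1))} (h : y ≠ 0) :
    (direction y : EuclideanSpace ℝ (Fin (d + 1))) = ‖y‖⁻¹ • y := by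
  rw [direction, dif_neg h]

theorem norm_smul_direction (y : EuclideanSpace ℝ (Fin (d + 1))) :
    ‖y‖ • (direction y : EuclideanSpace ℝ (Fin (d + 1))) = y := by
  by_cases h : y = 0
  · simp [h]
  · rw [coe_direction h, smul_smul, mul_inv_cancel₀ (norm_ne_zero_iff.mpr h), one_smul]

theorem direction_smul {c : ℝ} (hc : 0 < c) (y : EuclideanSpace ℝ (Fin (d + 1))) :
    direction (c • y) = direction y := by
  by_cases h : y = 0
  · simp [h]
  · ext1
    rw [coe_direction h, coe_direction (smul_ne_zero hc.ne' h), smul_smul, norm_smul,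
      Real.norm_of_nonneg hc.le]
    congr 1
    field_simp

theorem norm_coe_usphere (x : USphere d) : ‖(x : EuclideanSpace ℝ (Fin (d + 1)))‖ = 1 := by
  simp

theorem direction_coe (x : USphere d) :
    direction (x : EuclideanSpace ℝ (Fin (d + 1))) = x := by
  have h : (x : EuclideanSpace ℝ (Fin (d + 1))) ≠ 0 := by
    rw [← norm_ne_zero_iff, norm_coe_usphere]; exact one_ne_zero
  ext1
  rw [coe_direction h, norm_coe_usphere, inv_one, one_smul]

theorem continuousAt_direction {y : EuclideanSpace ℝ (Fin (d + 1))} (h : y ≠ 0) :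
    ContinuousAt (direction (d := d)) y := by
  rw [Topology.IsInducing.subtypeVal.continuousAt_iff]
  have e : (fun y : EuclideanSpace ℝ (Fin (d + 1)) => ‖y‖⁻¹ • y) =ᶠ[𝓝 y]
      (Subtype.val ∘ direction (d := d)) := by
    filter_upwards [isOpen_compl_singleton.mem_nhds h] with z hz
    exact (coe_direction hz).symm
  refine ContinuousAt.congr ?_ e
  exact (continuousAt_id.norm.inv₀ (norm_ne_zero_iff.mpr h)).smul continuousAt_id

/-- Continuity of a map given in polar coordinates. -/
theorem continuous_polar {X A Z : Type*} [TopologicalSpace X] [TopologicalSpace A]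
    [TopologicalSpace Z] {y : X → EuclideanSpace ℝ (Fin (d + 1))} (hy : Continuous y) {a : X → A}
    (ha : Continuous a) {k : USphere d × A → Z} (hk : Continuous k)
    (h : ∀ x, y x = 0 → ∀ u u', k (u, a x) = k (u', a x)) :
    Continuous fun x => k (direction (y x), a x) := by
  rw [continuous_iff_continuousAt]
  intro x
  by_cases h0 : y x = 0
  · rw [ContinuousAt, tendsto_nhds]
    intro U hU hxU
    obtain ⟨u, v, -, hv, hu, hxv, huv⟩ := generalized_tube_lemma
      (isCompact_univ (X := USphere d)) (isCompact_singleton (x := a x)) (hU.preimage hk)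
      (by
        rintro ⟨w, b⟩ ⟨-, hb⟩
        rw [Set.mem_singleton_iff] at hb
        subst hb
        change k (w, a x) ∈ U
        rw [h x h0 w (direction (y x))]
        exact hxU)
    filter_upwards [ha.continuousAt.preimage_mem_nhds (hv.mem_nhds (hxv rfl))] with x' hx'
    exact huv ⟨hu trivial, hx'⟩
  · exact hk.continuousAt.comp (f := fun x => (direction (y x), a x))
      (((continuousAt_direction h0).comp hy.continuousAt).prodMk ha.continuousAt)

/-- The vector with first coordinate `c` and remaining coordinates `y`. -/
noncomputable def consVec (c : ℝ) (y : EuclideanSpace ℝ (Fin (d + 1))) :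
    EuclideanSpace ℝ (Fin (d + 1 + 1)) :=
  WithLp.toLp 2 (Fin.cons c y.ofLp)

/-- The vector of all coordinates but the first. -/
noncomputable def tailVec (p : EuclideanSpace ℝ (Fin (d + 1 + 1))) :
    EuclideanSpace ℝ (Fin (d + 1)) :=
  WithLp.toLp 2 (fun i => p i.succ)

theorem tailVec_consVec (c : ℝ) (y : EuclideanSpace ℝ (Fin (d + 1))) :
    tailVec (consVec c y) = y := by
  ext i; simp [tailVec, consVec]

theorem consVec_zero (c : ℝ) (y : EuclideanSpace ℝ (Fin (d + 1))) : consVec c y 0 = c := by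
  simp [consVec]

theorem consVec_tailVec (p : EuclideanSpace ℝ (Fin (d + 1 + 1))) :
    consVec (p 0) (tailVec p) = p := by
  ext i
  refine Fin.cases ?_ (fun i => ?_) i <;> simp [tailVec, consVec]

theorem norm_sq_eq_tailVec (p : EuclideanSpace ℝ (Fin (d + 1 + 1))) :
    ‖p‖ ^ 2 = p 0 ^ 2 + ‖tailVec p‖ ^ 2 := by
  rw [EuclideanSpace.real_norm_sq_eq, EuclideanSpace.real_norm_sq_eq, Fin.sum_univ_succ]
  rfl

theorem continuous_tailVec : Continuous (tailVec (d := d)) := by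
  unfold tailVec; fun_prop

theorem continuous_consVec :
    Continuous fun q : ℝ × EuclideanSpace ℝ (Fin (d + 1)) => consVec q.1 q.2 := by
  unfold consVec
  refine (PiLp.continuous_toLp 2 _).comp (continuous_pi fun i => ?_)
  refine Fin.cases ?_ (fun i => ?_) i
  · simpa using continuous_fst
  · simp only [Fin.cons_succ]
    fun_prop

/-- The radius `ρ` of the points of the ball mapped to `p` by the collapse `bulge`. -/
noncomputable def capRadius (p : USphere (d + 1)) : ℝ := √((1 + p.1 0) / 2)

theorem usphere_sq (p : USphere (d + 1)) : p.1 0 ^ 2 + ‖tailVec p.1‖ ^ 2 = 1 := by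
  rw [← norm_sq_eq_tailVec, norm_coe_usphere, one_pow]

theorem capRadius_eq_of_tailVec_eq_zero {p : USphere (d + 1)} (h : tailVec p.1 = 0) :
    capRadius p = 0 ∨ capRadius p = 1 := by
  have := usphere_sq p
  rw [h, norm_zero] at this
  have h2 : (p.1 0 - 1) * (p.1 0 + 1) = 0 := by linarith
  rcases mul_eq_zero.mp h2 with h | h
  · right
    rw [capRadius, show p.1 0 = 1 by linarith]; norm_num
  · left
    rw [capRadius, show p.1 0 = -1 by linarith]; norm_num

theorem continuous_capRadius : Continuous (capRadius (d := d)) := by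
  unfold capRadius; fun_prop

theorem capRadius_nonneg (p : USphere (d + 1)) : 0 ≤ capRadius p := Real.sqrt_nonneg _

theorem capRadius_spherePt : capRadius (spherePt (d + 1)) = 1 := by
  simp [capRadius, spherePt]

/-- The map from the vector space onto the sphere which collapses the complement of the open unit
ball to the base point. -/
noncomputable def bulge (z : EuclideanSpace ℝ (Fin (d + 1))) : USphere (d + 1) :=
  ⟨consVec (2 * min 1 (‖z‖ ^ 2) - 1) ((2 * √(1 - min 1 (‖z‖ ^ 2))) • z), by
    rw [mem_sphere_zero_iff_norm, ← sq_eq_sq₀ (norm_nonneg _) zero_le_one, norm_sq_eq_tailVec,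
      tailVec_consVec, consVec_zero, norm_smul, mul_pow, Real.norm_eq_abs, sq_abs, mul_pow,
      Real.sq_sqrt (by simp)]
    rcases le_total 1 (‖z‖ ^ 2) with h | h
    · rw [min_eq_left h]; ring
    · rw [min_eq_right h]; ring⟩

theorem continuous_bulge : Continuous (bulge (d := d)) := by
  unfold bulge
  refine Continuous.subtype_mk ?_ _
  exact continuous_consVec.comp (f := fun z => (2 * min 1 (‖z‖ ^ 2) - 1,
    (2 * √(1 - min 1 (‖z‖ ^ 2))) • z)) (by fun_prop)

theorem coe_spherePt_succ : (spherePt (d + 1)).1 = consVec 1 0 := by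
  ext i
  refine Fin.cases ?_ (fun i => ?_) i <;> simp [spherePt, consVec]

theorem bulge_of_one_le {z : EuclideanSpace ℝ (Fin (d + 1))} (h : 1 ≤ ‖z‖) :
    bulge z = spherePt (d + 1) := by
  ext1
  rw [coe_spherePt_succ]
  change consVec _ _ = _
  rw [min_eq_left (one_le_pow₀ h)]
  norm_num

theorem capRadius_bulge (z : EuclideanSpace ℝ (Fin (d + 1))) :
    capRadius (bulge z) = min 1 ‖z‖ := by
  rw [capRadius]
  change √((1 + consVec _ _ 0) / 2) = _
  rw [consVec_zero, show (1 + (2 * min 1 (‖z‖ ^ 2) - 1)) / 2 = min 1 (‖z‖ ^ 2) by ring]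
  rcases le_total 1 ‖z‖ with h | h
  · rw [min_eq_left h, min_eq_left (one_le_pow₀ h), Real.sqrt_one]
  · rw [min_eq_right h, min_eq_right (pow_le_one₀ (norm_nonneg _) h),
      Real.sqrt_sq (norm_nonneg _)]

theorem direction_tailVec_bulge {z : EuclideanSpace ℝ (Fin (d + 1))} (h : ‖z‖ < 1) :
    direction (tailVec (bulge z).1) = direction z := by
  change direction (tailVec (consVec _ _)) = _
  rw [tailVec_consVec, direction_smul]
  have h2 : ‖z‖ ^ 2 < 1 := pow_lt_one₀ (norm_nonneg _) h two_ne_zero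
  rw [min_eq_right h2.le]
  have := Real.sqrt_pos.mpr (sub_pos.mpr h2)
  positivity

theorem bulge_capRadius_smul (p : USphere (d + 1)) :
    bulge (capRadius p • (direction (tailVec p.1)).1) = p := by
  have hp := usphere_sq p
  have hn : ‖capRadius p • (direction (tailVec p.1)).1‖ ^ 2 = (1 + p.1 0) / 2 := by
    rw [norm_smul, norm_coe_usphere, mul_one, Real.norm_of_nonneg (capRadius_nonneg p), capRadius,
      Real.sq_sqrt]
    nlinarith [sq_nonneg ‖tailVec p.1‖]
  ext1
  change consVec _ _ = _
  rw [hn, min_eq_right (by nlinarith [sq_nonneg ‖tailVec p.1‖])]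
  conv_rhs => rw [← consVec_tailVec p.1]
  congr 1
  · ring
  · rw [smul_smul]
    conv_rhs => rw [← norm_smul_direction (tailVec p.1)]
    congr 1
    rw [capRadius, mul_assoc, ← Real.sqrt_mul (by nlinarith [sq_nonneg ‖tailVec p.1‖]),
      ← sq_eq_sq₀ (by positivity) (norm_nonneg _), mul_pow, Real.sq_sqrt]
    · linarith
    · nlinarith [sq_nonneg ‖tailVec p.1‖]

theorem norm_spherePt : ‖(spherePt d).1‖ = 1 := norm_coe_usphere _

theorem one_le_norm_smul_add {a b : ℝ} (hb : 0 ≤ b) (h : 1 + b ≤ a) (x : USphere d) :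
    1 ≤ ‖a • x.1 + b • (spherePt d).1‖ := by
  have h1 : ‖a • x.1‖ = a := by
    rw [norm_smul, norm_coe_usphere, mul_one, Real.norm_of_nonneg (by linarith)]
  have h2 : ‖b • (spherePt d).1‖ = b := by
    rw [norm_smul, norm_spherePt, mul_one, Real.norm_of_nonneg hb]
  have := norm_sub_le (a • x.1 + b • (spherePt d).1) (b • (spherePt d).1)
  rw [add_sub_cancel_right] at this
  linarith

theorem norm_smul_spherePt {a : ℝ} (ha : 0 ≤ a) : ‖a • (spherePt d).1‖ = a := by
  rw [norm_smul, norm_spherePt, mul_one, Real.norm_of_nonneg ha]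

theorem direction_smul_coe {a : ℝ} (ha : 0 < a) (x : USphere d) :
    direction (a • x.1) = x := by
  rw [direction_smul ha, direction_coe]

theorem direction_smul_spherePt {a : ℝ} (ha : 0 ≤ a) :
    direction (a • (spherePt d).1) = spherePt d := by
  rcases ha.eq_or_lt with rfl | h
  · rw [zero_smul, direction_zero]
  · exact direction_smul_coe h _

end Polar

/-! ### The cone over a wedge of spheres -/

namespace WedgeOfSpheres

variable {κ₁ κ₂ : Type*} (d₁ : κ₁ → ℕ) (d₂ : κ₂ → ℕ)

/-- The mapping cone of the constant map between two wedges of spheres at the wedge point. -/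
abbrev ConstCone : Type _ := MCone (fun _ : WedgeOfSpheres κ₂ d₂ => pt κ₁ d₁)

/-- The dimensions of the spheres in the wedge of one wedge with the suspension of another. -/
abbrev joinDims : κ₁ ⊕ κ₂ → ℕ := Sum.elim d₁ (fun j => d₂ j + 1)

/-- The inclusion of a suspended sphere. -/
noncomputable def sphSucc (j : κ₂) :
    C(USphere (d₂ j + 1), WedgeOfSpheres (κ₁ ⊕ κ₂) (joinDims d₁ d₂)) :=
  sph (joinDims d₁ d₂) (Sum.inr j)

theorem sphSucc_spherePt (j : κ₂) : sphSucc d₁ d₂ j (spherePt (d₂ j + 1)) = pt _ _ :=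
  sph_spherePt (d := joinDims d₁ d₂) (Sum.inr j)

theorem sphSucc_bulge {j : κ₂} {z : EuclideanSpace ℝ (Fin (d₂ j + 1))} (h : 1 ≤ ‖z‖) :
    sphSucc d₁ d₂ j (bulge z) = pt _ _ := by
  rw [bulge_of_one_le h, sphSucc_spherePt]

/-- The inclusion of the first wedge. -/
noncomputable def inclWedge :
    C(WedgeOfSpheres κ₁ d₁, WedgeOfSpheres (κ₁ ⊕ κ₂) (joinDims d₁ d₂)) :=
  desc (pt _ _) (fun i => sph (joinDims d₁ d₂) (Sum.inl i))
    (fun i => sph_spherePt (d := joinDims d₁ d₂) (Sum.inl i))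

/-- The map from the cone which collapses the segment over the base point. -/
noncomputable def collapse :
    C(ConstCone d₁ d₂, WedgeOfSpheres (κ₁ ⊕ κ₂) (joinDims d₁ d₂)) :=
  MCone.desc (inclWedge d₁ d₂)
    (descProd (ContinuousMap.const ℝ (pt _ _))
      (fun j => ⟨fun p => sphSucc d₁ d₂ j
          (bulge ((2 * max 0 (1 - p.2)) • p.1.1 + (1 : ℝ) • (spherePt (d₂ j)).1)),
        (sphSucc d₁ d₂ j).continuous.comp (continuous_bulge.comp (by fun_prop))⟩)
      (fun j t => by
        refine sphSucc_bulge d₁ d₂ ?_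
        have := le_max_left 0 (1 - t)
        rw [← add_smul, norm_smul_spherePt] <;> linarith))
    (pt _ _)
    (fun c t ht => by
      induction c using ind with
      | h₀ =>
        rfl
      | h₁ j x =>
        refine sphSucc_bulge d₁ d₂ (one_le_norm_smul_add zero_le_one ?_ x)
        rw [max_eq_right (by linarith)]; linarith)
    (fun c t ht => by
      induction c using ind with
      | h₀ =>
        rfl
      | h₁ j x =>
        refine sphSucc_bulge d₁ d₂ ?_
        rw [max_eq_left (by linarith), mul_zero, zero_smul, zero_add,
          norm_smul_spherePt zero_le_one])

/-- The map from the closed ball to a cone. -/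
noncomputable def ballMap (j : κ₂) : C(EuclideanSpace ℝ (Fin (d₂ j + 1)), ConstCone d₁ d₂) :=
  ⟨fun z => MCone.cyl _ (sph d₂ j (direction z), 1 - ‖z‖), by
    refine continuous_polar (y := fun z => z) continuous_id (a := fun z => ‖z‖) continuous_norm
      (k := fun p => MCone.cyl (fun _ : WedgeOfSpheres κ₂ d₂ => pt κ₁ d₁)
        (sph d₂ j p.1, 1 - p.2)) (by fun_prop) ?_
    rintro z rfl u u'
    rw [norm_zero, MCone.cyl_of_ge _ (by norm_num), MCone.cyl_of_ge _ (by norm_num)]⟩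

theorem ballMap_of_one_le {j : κ₂} {z : EuclideanSpace ℝ (Fin (d₂ j + 1))} (h : 1 ≤ ‖z‖) :
    ballMap d₁ d₂ j z = MCone.incl _ (pt _ _) :=
  MCone.cyl_of_le _ (by linarith)

theorem ballMap_smul_spherePt (j : κ₂) {a : ℝ} (ha : 0 ≤ a) :
    ballMap d₁ d₂ j (a • (spherePt (d₂ j)).1) = MCone.cyl _ (pt _ _, 1 - a) := by
  change MCone.cyl _ (sph d₂ j (direction _), 1 - ‖_‖) = _
  rw [direction_smul_spherePt ha, norm_smul_spherePt ha, sph_spherePt]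

/-- The map from a suspended sphere to the cone. -/
noncomputable def pinch (j : κ₂) : C(USphere (d₂ j + 1), ConstCone d₁ d₂) :=
  ⟨fun p => MCone.cyl _ (sph d₂ j (direction (tailVec p.1)), 1 - capRadius p), by
    refine continuous_polar (y := fun p : USphere (d₂ j + 1) => tailVec p.1)
      (continuous_tailVec.comp continuous_subtype_val) (a := capRadius) continuous_capRadius
      (k := fun p => MCone.cyl (fun _ : WedgeOfSpheres κ₂ d₂ => pt κ₁ d₁)
        (sph d₂ j p.1, 1 - p.2)) (by fun_prop) ?_
    intro p hp u u'
    rcases capRadius_eq_of_tailVec_eq_zero hp with h | h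
    · rw [h, MCone.cyl_of_ge _ (by norm_num), MCone.cyl_of_ge _ (by norm_num)]
    · rw [h, MCone.cyl_of_le _ (by norm_num), MCone.cyl_of_le _ (by norm_num)]⟩

theorem pinch_spherePt (j : κ₂) :
    pinch d₁ d₂ j (spherePt (d₂ j + 1)) = MCone.incl _ (pt _ _) := by
  refine MCone.cyl_of_le _ ?_
  rw [capRadius_spherePt, sub_self]

theorem pinch_bulge (j : κ₂) (z : EuclideanSpace ℝ (Fin (d₂ j + 1))) :
    pinch d₁ d₂ j (bulge z) = ballMap d₁ d₂ j z := by
  rcases le_or_gt 1 ‖z‖ with h | h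
  · rw [bulge_of_one_le h, pinch_spherePt, ballMap_of_one_le d₁ d₂ h]
  · change MCone.cyl _ (sph d₂ j (direction (tailVec (bulge z).1)), 1 - capRadius (bulge z)) = _
    rw [direction_tailVec_bulge h, capRadius_bulge, min_eq_right h.le]
    rfl

/-- The map from the wedge to the cone. -/
noncomputable def expand :
    C(WedgeOfSpheres (κ₁ ⊕ κ₂) (joinDims d₁ d₂), ConstCone d₁ d₂) :=
  desc (d := joinDims d₁ d₂) (MCone.incl _ (pt _ _))
    (fun i => match i with
      | Sum.inl i => (MCone.incl _).comp (sph d₁ i)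
      | Sum.inr j => pinch d₁ d₂ j)
    (fun i => match i with
      | Sum.inl i => congrArg (MCone.incl _) (sph_spherePt (d := d₁) i)
      | Sum.inr j => pinch_spherePt d₁ d₂ j)

theorem expand_sphSucc (j : κ₂) (p : USphere (d₂ j + 1)) :
    expand d₁ d₂ (sphSucc d₁ d₂ j p) = pinch d₁ d₂ j p := rfl

theorem expand_comp_collapse :
    ((expand d₁ d₂).comp (collapse d₁ d₂)).Homotopic (ContinuousMap.id _) := by
  refine Homotopic.symm (MCone.homotopic_of
    ((MCone.incl _).comp ⟨Prod.fst, continuous_fst⟩)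
    ((descProd (A := ℝ × unitInterval)
      ⟨fun q => MCone.cyl (fun _ : WedgeOfSpheres κ₂ d₂ => pt κ₁ d₁)
        (pt κ₂ d₂, 1 - ((1 + (q.2 : ℝ)) * max 0 (1 - q.1) + q.2)), by fun_prop⟩
      (fun j => ⟨fun p => ballMap d₁ d₂ j (((1 + (p.2.2 : ℝ)) * max 0 (1 - p.2.1)) • p.1.1 +
        (p.2.2 : ℝ) • (spherePt (d₂ j)).1), (ballMap d₁ d₂ j).continuous.comp (by fun_prop)⟩)
      (fun j q => ?_)).comp ⟨fun p => (p.1.1, (p.1.2, p.2)), by fun_prop⟩)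
    ⟨fun s => MCone.cyl (fun _ : WedgeOfSpheres κ₂ d₂ => pt κ₁ d₁)
      (pt κ₂ d₂, 1 - (s : ℝ)), by fun_prop⟩ ?_ ?_ ?_ ?_ ?_ ?_ ?_ ?_)
  · have h1 := q.2.2.1
    have h2 := le_max_left 0 (1 - q.1)
    simp only [ContinuousMap.coe_mk]
    rw [← add_smul, ballMap_smul_spherePt d₁ d₂ j (by positivity)]
  · intro c t s ht
    have hs := s.2.1
    induction c using ind with
    | h₀ =>
      refine MCone.cyl_of_le _ ?_
      change 1 - ((1 + (s : ℝ)) * max 0 (1 - t) + (s : ℝ)) ≤ 0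
      rw [max_eq_right (by linarith)]
      nlinarith
    | h₁ j x =>
      refine ballMap_of_one_le d₁ d₂ (one_le_norm_smul_add hs ?_ x)
      change 1 + (s : ℝ) ≤ (1 + (s : ℝ)) * max 0 (1 - t)
      rw [max_eq_right (by linarith)]
      nlinarith
  · intro c t s ht
    induction c using ind with
    | h₀ =>
      change MCone.cyl _ (_, 1 - (_ * max 0 (1 - t) + (s : ℝ))) = _
      rw [max_eq_left (by linarith), mul_zero, zero_add]; rfl
    | h₁ j x =>
      change ballMap d₁ d₂ j ((_ * max 0 (1 - t)) • x.1 + (s : ℝ) • _) = _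
      rw [max_eq_left (by linarith), mul_zero, zero_smul, zero_add,
        ballMap_smul_spherePt d₁ d₂ j s.2.1]
      rfl
  · exact fun _ => rfl
  · intro c
    exact ind (P := fun c => MCone.incl _ c = expand d₁ d₂ (inclWedge d₁ d₂ c)) rfl
      (fun _ _ => rfl) c
  · intro c t h0 h1
    induction c using ind with
    | h₀ =>
      change MCone.cyl _ (_, 1 - ((1 + (0 : ℝ)) * max 0 (1 - t) + (0 : ℝ))) = MCone.cyl _ (_, t)
      rw [max_eq_right (by linarith)]
      congr 2; ring
    | h₁ j x =>
      change ballMap d₁ d₂ j (((1 + (0 : ℝ)) * max 0 (1 - t)) • x.1 + (0 : ℝ) • _) =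
        MCone.cyl _ (sph d₂ j x, t)
      rw [max_eq_right (by linarith), add_zero, one_mul, zero_smul, add_zero]
      change MCone.cyl _ (sph d₂ j (direction _), 1 - ‖_‖) = _
      rw [direction_smul_coe (by linarith), norm_smul, norm_coe_usphere, mul_one,
        Real.norm_of_nonneg (by linarith), sub_sub_cancel]
  · intro c t h0 h1
    induction c using ind with
    | h₀ =>
      refine MCone.cyl_of_le _ ?_
      change 1 - ((1 + (1 : ℝ)) * max 0 (1 - t) + (1 : ℝ)) ≤ 0
      have := le_max_left 0 (1 - t)
      linarith
    | h₁ j x =>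
      change ballMap d₁ d₂ j (((1 + (1 : ℝ)) * max 0 (1 - t)) • x.1 + (1 : ℝ) • _) =
        expand d₁ d₂ (sphSucc d₁ d₂ j (bulge _))
      rw [expand_sphSucc, pinch_bulge, one_add_one_eq_two]
  · exact MCone.cyl_of_ge _ (by simp)
  · exact MCone.cyl_of_le _ (by simp)

theorem collapse_comp_expand :
    ((collapse d₁ d₂).comp (expand d₁ d₂)).Homotopic (ContinuousMap.id _) := by
  refine Homotopic.symm (homotopic_of (d := joinDims d₁ d₂) (ContinuousMap.const _ (pt _ _))
    (fun i => match i with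
      | Sum.inl i => (sph (joinDims d₁ d₂) (Sum.inl i)).comp ⟨Prod.fst, continuous_fst⟩
      | Sum.inr j => ⟨fun p : USphere (d₂ j + 1) × unitInterval => sphSucc d₁ d₂ j
          (bulge (((1 + (p.2 : ℝ)) * capRadius p.1) • (direction (tailVec p.1.1)).1 +
            (p.2 : ℝ) • (spherePt (d₂ j)).1)), ?_⟩) ?_ rfl rfl ?_ ?_)
  · refine continuous_polar (y := fun p : USphere (d₂ j + 1) × unitInterval => tailVec p.1.1)
      (continuous_tailVec.comp (continuous_subtype_val.comp continuous_fst))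
      (a := fun p => (capRadius p.1, (p.2 : ℝ)))
      ((continuous_capRadius.comp continuous_fst).prodMk
        (continuous_subtype_val.comp continuous_snd))
      (k := fun q => sphSucc d₁ d₂ j (bulge (((1 + q.2.2) * q.2.1) • q.1.1 +
        q.2.2 • (spherePt (d₂ j)).1)))
      ((sphSucc d₁ d₂ j).continuous.comp (continuous_bulge.comp (by fun_prop))) ?_
    intro p hp u u'
    rcases capRadius_eq_of_tailVec_eq_zero hp with h | h
    · simp only [h, mul_zero, zero_smul]
    · have hs := p.2.2.1
      simp only [h, mul_one]
      rw [sphSucc_bulge d₁ d₂ (one_le_norm_smul_add hs le_rfl u),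
        sphSucc_bulge d₁ d₂ (one_le_norm_smul_add hs le_rfl u')]
  · rintro (i | j) s
    · exact sph_spherePt (d := joinDims d₁ d₂) (Sum.inl i)
    · refine sphSucc_bulge d₁ d₂ (one_le_norm_smul_add s.2.1 ?_ _)
      change _ ≤ _ * capRadius (spherePt (d₂ j + 1))
      rw [capRadius_spherePt, mul_one]
  · rintro (i | j) x
    · rfl
    · change sphSucc d₁ d₂ j (bulge (((1 + (0 : ℝ)) * capRadius _) • _ + (0 : ℝ) • _)) =
        sphSucc d₁ d₂ j x
      rw [add_zero, one_mul, zero_smul, add_zero, bulge_capRadius_smul]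
  · rintro (i | j) x
    · rfl
    · have key : ∀ p : USphere (d₂ j + 1),
          sphSucc d₁ d₂ j (bulge (((1 + (1 : ℝ)) * capRadius p) • (direction (tailVec p.1)).1 +
            (1 : ℝ) • (spherePt (d₂ j)).1)) =
          sphSucc d₁ d₂ j (bulge ((2 * max 0 (1 - (1 - capRadius p))) •
            (direction (tailVec p.1)).1 + (1 : ℝ) • (spherePt (d₂ j)).1)) := fun p => by
        rw [sub_sub_cancel, max_eq_right (capRadius_nonneg p), one_add_one_eq_two]
      exact key x

/-- The mapping cone of a constant map between wedges of spheres is a wedge of spheres. -/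
theorem isHtpyEquiv_collapse : IsHtpyEquiv (collapse d₁ d₂) :=
  ⟨expand d₁ d₂, expand_comp_collapse d₁ d₂, collapse_comp_expand d₁ d₂⟩

end WedgeOfSpheres

/-! ### Geometric realizations -/

section Realization

variable {α : Type*} [Fintype α] {K K' : Set (Finset α)} {σ : Finset α}

theorem realization_mono (h : K ⊆ K') : realization K ⊆ realization K' :=
  fun _ ⟨h₁, h₂, σ, hσ, h₃⟩ => ⟨h₁, h₂, σ, h hσ, h₃⟩

theorem realization_singleton_subset (hσ : σ ∈ K) : realization {σ} ⊆ realization K :=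
  realization_mono (Set.singleton_subset_iff.mpr hσ)

theorem convex_realization_singleton (σ : Finset α) : Convex ℝ (realization {σ}) := by
  rintro x ⟨hx₀, hx₁, _, rfl, hx⟩ y ⟨hy₀, hy₁, _, rfl, hy⟩ s t hs ht hst
  refine ⟨fun a => ?_, ?_, _, rfl, fun a ha => ?_⟩
  · have := hx₀ a
    have := hy₀ a
    simp only [Pi.add_apply, Pi.smul_apply, smul_eq_mul]
    positivity
  · simp only [Pi.add_apply, Pi.smul_apply, smul_eq_mul, sum_add_distrib, ← mul_sum, hx₁, hy₁,
      mul_one, hst]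
  · by_contra h
    refine ha ?_
    rw [Pi.add_apply, Pi.smul_apply, Pi.smul_apply, not_imp_comm.mp (hx a) h,
      not_imp_comm.mp (hy a) h, smul_zero, smul_zero, add_zero]

theorem isCompact_realization (K : Set (Finset α)) : IsCompact (realization K) := by
  have h : realization K = stdSimplex ℝ α ∩ ⋃ σ ∈ K, ⋂ a ∉ σ, {x | x a = 0} := by
    ext x
    simp only [realization, stdSimplex, Set.mem_ofPred_eq, Set.mem_inter_iff, Set.mem_iUnion,
      Set.mem_iInter, exists_prop, and_assoc, not_imp_comm, ne_eq]
  rw [h]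
  refine (isCompact_stdSimplex ℝ α).inter_right
    ((Set.toFinite K).isClosed_biUnion fun σ _ => isClosed_biInter fun a _ => ?_)
  exact isClosed_eq (continuous_apply a) continuous_const

instance (K : Set (Finset α)) : CompactSpace (realization K) :=
  isCompact_iff_compactSpace.mp (isCompact_realization K)

theorem joined_of_mem_realization_singleton {x y : realization K} (hσ : σ ∈ K)
    (hx : x.1 ∈ realization {σ}) (hy : y.1 ∈ realization {σ}) : Joined x y := by
  have h := (convex_realization_singleton σ).isPathConnected ⟨_, hx⟩ |>.joinedIn _ hx _ hy
  exact (h.mono (realization_singleton_subset hσ)).joined_subtype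

variable [DecidableEq α]

theorem single_mem_realization_singleton {a : α} (ha : a ∈ σ) :
    Pi.single a (1 : ℝ) ∈ realization {σ} := by
  refine ⟨fun b => ?_, by simp, _, rfl, fun b hb => ?_⟩
  · by_cases h : b = a
    · subst h; simp
    · simp [h]
  · by_cases h : b = a
    · rwa [h]
    · simp [h] at hb

/-- The vertex of the realization corresponding to a vertex of the complex. -/
noncomputable def vertexPt {a : α} (h : {a} ∈ K) : realization K :=
  ⟨Pi.single a 1, realization_singleton_subset h
    (single_mem_realization_singleton (mem_singleton_self a))⟩

end Realization

/-! ### The cone decomposition of a complex at a vertex -/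

section ConeDecomposition

theorem linkC_subset_delC {α : Type*} [DecidableEq α] (K : Set (Finset α)) (a : α) :
    linkC K a ⊆ delC K a :=
  fun _ h => ⟨h.1, h.2.1⟩

variable {α : Type*} [Fintype α] [DecidableEq α] {K : Set (Finset α)} {a : α}

/-- The inclusion of the link into the deletion. -/
def linkIncl (K : Set (Finset α)) (a : α) : C(realization (linkC K a), realization (delC K a)) :=
  ContinuousMap.inclusion (realization_mono (linkC_subset_delC K a))

theorem apply_eq_zero_of_mem_delC {x : α → ℝ} (hx : x ∈ realization (delC K a)) : x a = 0 := by
  obtain ⟨-, -, σ, hσ, h⟩ := hx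
  exact not_imp_comm.mp (h a) hσ.2

theorem cone_mem_realization {y : α → ℝ} (hy : y ∈ realization (linkC K a)) {s t : ℝ}
    (hs : 0 ≤ s) (ht : 0 ≤ t) (hst : s + t = 1) :
    s • y + t • Pi.single a (1 : ℝ) ∈ realization K := by
  obtain ⟨h₀, h₁, σ, hσ, h⟩ := hy
  refine realization_singleton_subset hσ.2.2 (convex_realization_singleton _
    ⟨h₀, h₁, _, rfl, fun b hb => mem_insert_of_mem (h b hb)⟩
    (single_mem_realization_singleton (mem_insert_self a σ)) hs ht hst)

/-- The map from the mapping cone of the inclusion of the link into the deletion. -/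
noncomputable def coneMap (ha : {a} ∈ K) : C(MCone (linkIncl K a), realization K) :=
  MCone.desc (ContinuousMap.inclusion (realization_mono fun _ h => h.1))
    ⟨fun p => ⟨(1 - max 0 (min 1 p.2)) • p.1.1 + (max 0 (min 1 p.2)) • Pi.single a (1 : ℝ),
      cone_mem_realization p.1.2 (sub_nonneg.mpr (max_le zero_le_one (min_le_left _ _)))
        (le_max_left _ _) (sub_add_cancel _ _)⟩, by fun_prop⟩
    (vertexPt ha)
    (fun y t ht => Subtype.ext (by
      change (1 - max 0 (min 1 t)) • y.1 + (max 0 (min 1 t)) • Pi.single a (1 : ℝ) = y.1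
      rw [max_eq_left ((min_le_right _ _).trans ht), sub_zero, one_smul, zero_smul, add_zero]))
    (fun y t ht => Subtype.ext (by
      change (1 - max 0 (min 1 t)) • y.1 + (max 0 (min 1 t)) • Pi.single a (1 : ℝ) =
        Pi.single a (1 : ℝ)
      rw [min_eq_left ht, max_eq_right zero_le_one, sub_self, one_smul, zero_smul, zero_add]))

theorem coneMap_cyl (ha : {a} ∈ K) (y : realization (linkC K a)) {t : ℝ} (h₀ : 0 < t)
    (h₁ : t < 1) :
    (coneMap ha (MCone.cyl _ (y, t))).1 = (1 - t) • y.1 + t • Pi.single a (1 : ℝ) := by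
  change (1 - max 0 (min 1 t)) • y.1 + (max 0 (min 1 t)) • Pi.single a (1 : ℝ) = _
  rw [min_eq_right h₁.le, max_eq_right h₀.le]

theorem coneMap_injective (ha : {a} ∈ K) : Function.Injective (coneMap ha) := by
  have hi : ∀ d, (coneMap ha (MCone.incl _ d)).1 a = 0 := fun d =>
    apply_eq_zero_of_mem_delC d.2
  have hc : ∀ y t, 0 < t → t < 1 → (coneMap ha (MCone.cyl _ (y, t))).1 a = t := by
    intro y t h₀ h₁
    rw [coneMap_cyl ha y h₀ h₁]
    simp [show y.1 a = 0 from apply_eq_zero_of_mem_delC (linkIncl K a y).2]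
  have hp : (coneMap ha (MCone.apex _)).1 a = 1 :=
    Pi.single_eq_same (M := fun _ => ℝ) a 1
  intro c c' h
  have h' : (coneMap ha c).1 = (coneMap ha c').1 := congrArg _ h
  have hh := congrFun h' a
  induction c using MCone.ind_Ioo with
  | h₁ d =>
    induction c' using MCone.ind_Ioo with
    | h₁ d' => exact congrArg _ (Subtype.ext h')
    | h₂ y' t' h₀' h₁' =>
      rw [hi, hc _ _ h₀' h₁'] at hh
      exact absurd hh h₀'.ne
    | h₃ =>
      rw [hi, hp] at hh
      exact absurd hh zero_ne_one
  | h₂ y t h₀ h₁ =>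
    induction c' using MCone.ind_Ioo with
    | h₁ d' =>
      rw [hi, hc _ _ h₀ h₁] at hh
      exact absurd hh h₀.ne'
    | h₂ y' t' h₀' h₁' =>
      rw [hc _ _ h₀ h₁, hc _ _ h₀' h₁'] at hh
      subst hh
      rw [coneMap_cyl ha y h₀ h₁, coneMap_cyl ha y' h₀ h₁] at h'
      have hy := smul_right_injective (α → ℝ) (sub_pos.mpr h₁).ne' (add_right_cancel h')
      rw [Subtype.ext hy]
    | h₃ =>
      rw [hc _ _ h₀ h₁, hp] at hh
      exact absurd hh h₁.ne
  | h₃ =>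
    induction c' using MCone.ind_Ioo with
    | h₁ d' =>
      rw [hi, hp] at hh
      exact absurd hh one_ne_zero
    | h₂ y' t' h₀' h₁' =>
      rw [hp, hc _ _ h₀' h₁'] at hh
      exact absurd hh h₁'.ne'
    | h₃ => rfl

theorem coneMap_surjective (hK : IsLowerSet K) (ha : {a} ∈ K) :
    Function.Surjective (coneMap ha) := by
  rintro ⟨x, h₀, h₁, σ, hσ, hx⟩
  rcases (h₀ a).eq_or_lt with h | h
  · refine ⟨MCone.incl _ ⟨x, h₀, h₁, σ.erase a, ⟨hK (erase_subset a σ) hσ, notMem_erase a σ⟩,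
      fun b hb => mem_erase.mpr ⟨?_, hx b hb⟩⟩, rfl⟩
    rintro rfl
    exact hb h.symm
  · have hs : x a + ∑ b ∈ univ.erase a, x b = 1 := by
      rw [add_sum_erase univ x (mem_univ a), h₁]
    have hle : 0 ≤ ∑ b ∈ univ.erase a, x b := sum_nonneg fun b _ => h₀ b
    rcases hle.eq_or_lt with h' | h'
    · refine ⟨MCone.apex _, Subtype.ext (funext fun b => ?_)⟩
      change (Pi.single a (1 : ℝ) : α → ℝ) b = x b
      by_cases hb : b = a
      · subst hb
        rw [Pi.single_eq_same]; linarith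
      · rw [Pi.single_eq_of_ne hb]
        exact ((sum_eq_zero_iff_of_nonneg fun b _ => h₀ b).mp h'.symm b
          (mem_erase.mpr ⟨hb, mem_univ b⟩)).symm
    · have h1a : 0 < 1 - x a := by linarith
      have hy : (1 - x a)⁻¹ • Function.update x a 0 ∈ realization (linkC K a) := by
        refine ⟨fun b => ?_, ?_, σ.erase a, ⟨hK (erase_subset a σ) hσ, notMem_erase a σ, ?_⟩,
          fun b hb => ?_⟩
        · refine mul_nonneg (inv_nonneg.mpr h1a.le) ?_
          rw [Function.update_apply]
          split_ifs
          exacts [le_rfl, h₀ b]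
        · simp only [Pi.smul_apply, smul_eq_mul, ← mul_sum]
          rw [sum_update_of_mem (mem_univ a), zero_add, sdiff_singleton_eq_erase,
            inv_mul_eq_one₀ h1a.ne']
          linarith
        · rwa [insert_erase (hx a h.ne')]
        · rw [Pi.smul_apply, Function.update_apply] at hb
          split_ifs at hb with hba
          · simp at hb
          · exact mem_erase.mpr ⟨hba, hx b fun hxb => hb (by rw [hxb, smul_zero])⟩
      refine ⟨MCone.cyl _ (⟨_, hy⟩, x a), Subtype.ext ?_⟩
      rw [coneMap_cyl ha _ h (by linarith), smul_inv_smul₀ h1a.ne']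
      funext b
      by_cases hb : b = a
      · subst hb; simp
      · simp [hb]

/-- A complex is the mapping cone of the inclusion of the link of a vertex in its deletion. -/
noncomputable def coneHomeomorph (hK : IsLowerSet K) (ha : {a} ∈ K) :
    MCone (linkIncl K a) ≃ₜ realization K :=
  haveI := MCone.compactSpace (linkIncl K a)
  Continuous.homeoOfEquivCompactToT2
    (f := Equiv.ofBijective (coneMap ha) ⟨coneMap_injective ha, coneMap_surjective hK ha⟩)
    (coneMap ha).continuous

end ConeDecomposition

/-! ### Wedges of two spaces -/

namespace wedgeTwo

variable {X Y : Type*} [TopologicalSpace X] [TopologicalSpace Y] (x₀ : X) (y₀ : Y)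

/-- The inclusion of the first space. -/
def inl : C(X, wedgeTwo X Y x₀ y₀) :=
  ⟨fun x => Quot.mk _ (Sum.inl x), continuous_quot_mk.comp continuous_inl⟩

/-- The inclusion of the second space. -/
def inr : C(Y, wedgeTwo X Y x₀ y₀) :=
  ⟨fun y => Quot.mk _ (Sum.inr y), continuous_quot_mk.comp continuous_inr⟩

theorem inl_eq_inr : inl x₀ y₀ x₀ = inr x₀ y₀ y₀ :=
  Quot.sound ⟨Or.inl rfl, Or.inr rfl⟩

/-- The embedding of the wedge in the product. -/
def toProd : C(wedgeTwo X Y x₀ y₀, X × Y) :=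
  ⟨Quot.lift (Sum.elim (fun x => (x, y₀)) fun y => (x₀, y)) (by
      rintro _ _ ⟨rfl | rfl, rfl | rfl⟩ <;> rfl),
    continuous_quot_lift _ (by fun_prop)⟩

theorem toProd_injective : Function.Injective (toProd x₀ y₀) := by
  intro a b h
  induction a using Quot.ind with
  | mk a =>
    induction b using Quot.ind with
    | mk b =>
      rcases a with x | y <;> rcases b with x' | y'
      · exact congrArg (inl x₀ y₀) (Prod.ext_iff.mp h).1
      · obtain ⟨rfl, rfl⟩ := Prod.ext_iff.mp (show (x, y₀) = (x₀, y') from h)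
        exact inl_eq_inr _ _
      · obtain ⟨rfl, rfl⟩ := Prod.ext_iff.mp (show (x₀, y) = (x', y₀) from h)
        exact (inl_eq_inr _ _).symm
      · exact congrArg (inr x₀ y₀) (Prod.ext_iff.mp h).2

instance [T2Space X] [T2Space Y] : T2Space (wedgeTwo X Y x₀ y₀) :=
  .of_injective_continuous (toProd_injective x₀ y₀) (toProd x₀ y₀).continuous

end wedgeTwo

/-! ### Suspensions -/

section Suspension

variable {α : Type*} {L : Set (Finset α)}

/-- The point at height `r` on the suspension of the point `y`. -/
def suspCoord (y : α → ℝ) (r : ℝ) : α ⊕ Fin 2 → ℝ :=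
  Sum.elim ((1 - |r|) • y) ![max 0 (-r), max 0 r]

theorem suspCoord_sub (y : α → ℝ) (r : ℝ) :
    suspCoord y r (Sum.inr 1) - suspCoord y r (Sum.inr 0) = r := by
  change max 0 r - max 0 (-r) = r
  rcases le_total 0 r with hr | hr
  · rw [max_eq_right hr, max_eq_left (neg_nonpos.mpr hr), sub_zero]
  · rw [max_eq_left hr, max_eq_right (neg_nonneg.mpr hr), zero_sub, neg_neg]

variable [DecidableEq α]

theorem suspCoord_neg_one (y : α → ℝ) : suspCoord y (-1) = Pi.single (Sum.inr 0) (1 : ℝ) := by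
  ext (a | i)
  · simp [suspCoord]
  · fin_cases i <;> simp [suspCoord]

theorem suspCoord_one (y : α → ℝ) : suspCoord y 1 = Pi.single (Sum.inr 1) (1 : ℝ) := by
  ext (a | i)
  · simp [suspCoord]
  · fin_cases i <;> simp [suspCoord]

theorem inr_zero_mem_suspC (hL : ∅ ∈ L) : {Sum.inr 0} ∈ suspC L :=
  ⟨∅, hL, {Sum.inr 0}, by simp, by simp⟩

theorem inr_one_mem_suspC (hL : ∅ ∈ L) : {Sum.inr 1} ∈ suspC L :=
  ⟨∅, hL, {Sum.inr 1}, by simp, by simp⟩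

variable [Fintype α]

theorem suspCoord_mem {y : α → ℝ} (hy : y ∈ realization L) {r : ℝ} (hr : |r| ≤ 1) :
    suspCoord y r ∈ realization (suspC L) := by
  obtain ⟨h₀, h₁, σ, hσ, h⟩ := hy
  have hn : ∀ a, suspCoord y r (Sum.inl a) ≠ 0 → a ∈ σ := fun a ha =>
    h a fun hya => ha (by simp [suspCoord, hya])
  refine ⟨?_, ?_, ?_⟩
  · rintro (a | i)
    · exact mul_nonneg (sub_nonneg.mpr hr) (h₀ a)
    · fin_cases i <;> exact le_max_left _ _
  · simp only [suspCoord, Fintype.sum_sum_type, Sum.elim_inl, Sum.elim_inr, Pi.smul_apply,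
      smul_eq_mul, ← mul_sum, h₁, mul_one, Fin.sum_univ_two, Matrix.cons_val_zero,
      Matrix.cons_val_one]
    rcases le_total 0 r with hr' | hr'
    · rw [abs_of_nonneg hr', max_eq_left (by linarith), max_eq_right hr']; ring
    · rw [abs_of_nonpos hr', max_eq_right (by linarith), max_eq_left hr']; ring
  · rcases le_total 0 r with hr' | hr'
    · refine ⟨_, ⟨σ, hσ, {Sum.inr 1}, by simp, rfl⟩, ?_⟩
      rintro (a | i) ha
      · simpa using hn a ha
      · fin_cases i
        · exact absurd (max_eq_left (neg_nonpos.mpr hr')) ha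
        · simp
    · refine ⟨_, ⟨σ, hσ, {Sum.inr 0}, by simp, rfl⟩, ?_⟩
      rintro (a | i) ha
      · simpa using hn a ha
      · fin_cases i
        · simp
        · exact absurd (max_eq_left hr') ha

/-- Every point of a suspension is a suspension point or lies on the suspension of a point. -/
theorem exists_suspCoord {z : α ⊕ Fin 2 → ℝ} (hz : z ∈ realization (suspC L)) :
    z = Pi.single (Sum.inr 0) (1 : ℝ) ∨ z = Pi.single (Sum.inr 1) (1 : ℝ) ∨
      ∃ y ∈ realization L, ∃ r : ℝ, |r| < 1 ∧ z = suspCoord y r := by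
  obtain ⟨h₀, h₁, _, ⟨σ, hσ, s, hs, rfl⟩, h⟩ := hz
  have hz : z (Sum.inr 0) = 0 ∨ z (Sum.inr 1) = 0 := by
    by_contra! hne
    have h2 := h _ hne.1
    have h3 := h _ hne.2
    rcases hs with rfl | rfl | rfl <;> simp at h2 h3
  have hz₀ := h₀ (Sum.inr 0)
  have hz₁ := h₀ (Sum.inr 1)
  obtain ⟨r, hr₀, hr₁, hr⟩ : ∃ r : ℝ, z (Sum.inr 0) = max 0 (-r) ∧ z (Sum.inr 1) = max 0 r ∧
      |r| = z (Sum.inr 0) + z (Sum.inr 1) := by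
    refine ⟨z (Sum.inr 1) - z (Sum.inr 0), ?_⟩
    rcases hz with hz | hz
    · rw [hz, sub_zero, max_eq_left (by linarith), max_eq_right hz₁, abs_of_nonneg hz₁, zero_add]
      exact ⟨rfl, rfl, rfl⟩
    · rw [hz, zero_sub, neg_neg, max_eq_right hz₀, max_eq_left (by linarith), abs_neg,
        abs_of_nonneg hz₀, add_zero]
      exact ⟨rfl, rfl, rfl⟩
  rw [Fintype.sum_sum_type, Fin.sum_univ_two, ← hr] at h₁
  have hle : 0 ≤ ∑ a, z (Sum.inl a) := sum_nonneg fun a _ => h₀ _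
  have hσ' : ∀ a, z (Sum.inl a) ≠ 0 → a ∈ σ := fun a ha => by
    have h2 := h _ ha
    rcases hs with rfl | rfl | rfl <;> simpa using h2
  rcases hle.eq_or_lt with h' | h'
  · have ha : ∀ a, z (Sum.inl a) = 0 := fun a =>
      (sum_eq_zero_iff_of_nonneg fun a _ => h₀ (Sum.inl a)).mp h'.symm a (mem_univ a)
    rcases hz with hz | hz
    · right; left
      ext (a | i)
      · simp [ha]
      · fin_cases i
        · simp [hz]
        · simp only [Fin.mk_one, Pi.single_eq_same]
          linarith
    · left
      ext (a | i)
      · simp [ha]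
      · fin_cases i
        · simp only [Fin.zero_eta, Pi.single_eq_same]
          linarith
        · simp [hz]
  · have hpos : 0 < 1 - |r| := by linarith
    refine Or.inr (Or.inr ⟨(1 - |r|)⁻¹ • fun a => z (Sum.inl a), ⟨fun a => ?_, ?_, σ, hσ,
      fun a ha => hσ' a fun h2 => ha ?_⟩, r, by linarith, ?_⟩)
    · exact mul_nonneg (inv_nonneg.mpr hpos.le) (h₀ _)
    · simp only [Pi.smul_apply, smul_eq_mul, ← mul_sum]
      rw [inv_mul_eq_one₀ hpos.ne']
      linarith
    · rw [Pi.smul_apply, h2, smul_zero]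
    · rw [suspCoord, smul_inv_smul₀ hpos.ne']
      ext (a | i)
      · rfl
      · fin_cases i
        · exact hr₀
        · exact hr₁

/-- The height of a point of a suspension. -/
def suspHeight (z : realization (suspC L)) : ℝ := z.1 (Sum.inr 1) - z.1 (Sum.inr 0)

theorem suspHeight_inr_zero (h : {Sum.inr 0} ∈ suspC L) : suspHeight (vertexPt h) = -1 := by
  simp [suspHeight, vertexPt]

theorem suspHeight_inr_one (h : {Sum.inr 1} ∈ suspC L) : suspHeight (vertexPt h) = 1 := by
  simp [suspHeight, vertexPt]

/-- The parametrization of a suspension. -/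
noncomputable def suspPt (L : Set (Finset α)) : C(realization L × ℝ, realization (suspC L)) :=
  ⟨fun p => ⟨suspCoord p.1.1 (max (-1) (min 1 (2 * p.2 - 1))),
    suspCoord_mem p.1.2 (abs_le.mpr ⟨le_max_left _ _, max_le (by norm_num) (min_le_left _ _)⟩)⟩, by
    refine Continuous.subtype_mk (continuous_pi ?_) _
    rintro (a | i)
    · simp only [suspCoord, Sum.elim_inl]
      fun_prop
    · fin_cases i
      · exact Continuous.max continuous_const (by fun_prop)
      · exact Continuous.max continuous_const (by fun_prop)⟩

theorem suspPt_coe (y : realization L) {t : ℝ} (h₀ : 0 ≤ t) (h₁ : t ≤ 1) :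
    (suspPt L (y, t)).1 = suspCoord y.1 (2 * t - 1) := by
  change suspCoord y.1 (max (-1) (min 1 (2 * t - 1))) = _
  rw [min_eq_right (by linarith), max_eq_right (by linarith)]

theorem suspPt_of_le (hL : ∅ ∈ L) (y : realization L) {t : ℝ} (ht : t ≤ 0) :
    suspPt L (y, t) = vertexPt (inr_zero_mem_suspC hL) := by
  refine Subtype.ext ((congrArg (suspCoord y.1) ?_).trans (suspCoord_neg_one y.1))
  simp only
  rw [min_eq_right (by linarith), max_eq_left (by linarith)]

theorem suspPt_of_ge (hL : ∅ ∈ L) (y : realization L) {t : ℝ} (ht : 1 ≤ t) :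
    suspPt L (y, t) = vertexPt (inr_one_mem_suspC hL) := by
  refine Subtype.ext ((congrArg (suspCoord y.1) ?_).trans (suspCoord_one y.1))
  simp only
  rw [min_eq_left (by linarith), max_eq_right (by norm_num)]

end Suspension

section WedgeSuspension

variable {α X : Type*} [Fintype α] [DecidableEq α] {L : Set (Finset α)} [TopologicalSpace X]

/-- The map from the mapping cone of a constant map to the wedge with the suspension. -/
noncomputable def wedgeMap (hL : ∅ ∈ L) (x₀ : X) :
    C(MCone (fun _ : realization L => x₀),
      wedgeTwo X (realization (suspC L)) x₀ (vertexPt (inr_zero_mem_suspC hL))) :=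
  MCone.desc (wedgeTwo.inl _ _) ((wedgeTwo.inr _ _).comp (suspPt L))
    (wedgeTwo.inr _ _ (vertexPt (inr_one_mem_suspC hL)))
    (fun y _ ht => (congrArg (wedgeTwo.inr _ _) (suspPt_of_le hL y ht)).trans
      (wedgeTwo.inl_eq_inr _ _).symm)
    (fun y _ ht => congrArg (wedgeTwo.inr _ _) (suspPt_of_ge hL y ht))

theorem wedgeMap_injective (hL : ∅ ∈ L) (x₀ : X) : Function.Injective (wedgeMap hL x₀) := by
  intro c c' h
  have h₁ := congrArg (wedgeTwo.toProd _ _) h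
  have h₂ := congrArg (fun p => suspHeight p.2) h₁
  have hi : ∀ x, suspHeight (wedgeTwo.toProd _ _ (wedgeMap hL x₀ (MCone.incl _ x))).2 = -1 :=
    fun x => suspHeight_inr_zero (inr_zero_mem_suspC hL)
  have hp : suspHeight (wedgeTwo.toProd _ _ (wedgeMap hL x₀ (MCone.apex _))).2 = 1 :=
    suspHeight_inr_one (inr_one_mem_suspC hL)
  have hs : ∀ y t, 0 < t → t < 1 →
      (wedgeTwo.toProd _ _ (wedgeMap hL x₀ (MCone.cyl _ (y, t)))).2.1 =
        suspCoord y.1 (2 * t - 1) := fun y t h₀ h₁ => suspPt_coe y h₀.le h₁.le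
  have hc : ∀ y t, 0 < t → t < 1 →
      suspHeight (wedgeTwo.toProd _ _ (wedgeMap hL x₀ (MCone.cyl _ (y, t)))).2 = 2 * t - 1 := by
    intro y t h₀ h₁
    rw [suspHeight, hs y t h₀ h₁, suspCoord_sub]
  clear h
  induction c using MCone.ind_Ioo with
  | h₁ x =>
    induction c' using MCone.ind_Ioo with
    | h₁ x' => exact congrArg _ (Prod.ext_iff.mp h₁).1
    | h₂ y' t' h₀' h₁' =>
      rw [hi, hc _ _ h₀' h₁'] at h₂
      linarith
    | h₃ =>
      rw [hi, hp] at h₂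
      linarith
  | h₂ y t h₀ ht =>
    induction c' using MCone.ind_Ioo with
    | h₁ x' =>
      rw [hi, hc _ _ h₀ ht] at h₂
      linarith
    | h₂ y' t' h₀' h₁' =>
      rw [hc _ _ h₀ ht, hc _ _ h₀' h₁'] at h₂
      obtain rfl : t = t' := by linarith
      have h₃ := congrArg (fun p => p.2.1) h₁
      rw [hs y t h₀ ht, hs y' t h₀ ht] at h₃
      have h₄ : (1 - |2 * t - 1|) • y.1 = (1 - |2 * t - 1|) • y'.1 :=
        funext fun a => congrFun h₃ (Sum.inl a)
      have h₅ : |2 * t - 1| < 1 := abs_lt.mpr ⟨by linarith, by linarith⟩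
      rw [Subtype.ext (smul_right_injective (α → ℝ) (sub_pos.mpr h₅).ne' h₄)]
    | h₃ =>
      rw [hc _ _ h₀ ht, hp] at h₂
      linarith
  | h₃ =>
    induction c' using MCone.ind_Ioo with
    | h₁ x' =>
      rw [hi, hp] at h₂
      linarith
    | h₂ y' t' h₀' h₁' =>
      rw [hp, hc _ _ h₀' h₁'] at h₂
      linarith
    | h₃ => rfl

theorem wedgeMap_surjective (hL : ∅ ∈ L) (x₀ : X) : Function.Surjective (wedgeMap hL x₀) := by
  intro c
  induction c using Quot.ind with
  | mk a =>
    rcases a with x | ⟨z, hz⟩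
    · exact ⟨MCone.incl _ x, rfl⟩
    · rcases exists_suspCoord hz with rfl | rfl | ⟨y, hy, r, hr, rfl⟩
      · exact ⟨MCone.incl _ x₀, wedgeTwo.inl_eq_inr _ _⟩
      · exact ⟨MCone.apex _, rfl⟩
      · rw [abs_lt] at hr
        refine ⟨MCone.cyl _ (⟨y, hy⟩, (r + 1) / 2),
          congrArg (wedgeTwo.inr _ _) (Subtype.ext ?_)⟩
        rw [suspPt_coe _ (by linarith) (by linarith)]
        congr 1
        ring

/-- The mapping cone of a constant map is the wedge with the suspension. -/
noncomputable def wedgeHomeomorph [CompactSpace X] [T2Space X] (hL : ∅ ∈ L) (x₀ : X) :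
    MCone (fun _ : realization L => x₀) ≃ₜ
      wedgeTwo X (realization (suspC L)) x₀ (vertexPt (inr_zero_mem_suspC hL)) :=
  haveI := MCone.compactSpace (fun _ : realization L => x₀)
  Continuous.homeoOfEquivCompactToT2
    (f := Equiv.ofBijective (wedgeMap hL x₀) ⟨wedgeMap_injective hL x₀, wedgeMap_surjective hL x₀⟩)
    (wedgeMap hL x₀).continuous

end WedgeSuspension

/-! ### Moving the base point of a wedge of spheres -/

theorem IsHtpyEquiv.comp {X Y Z : Type*} [TopologicalSpace X] [TopologicalSpace Y]
    [TopologicalSpace Z] {g : C(Y, Z)} {f : C(X, Y)} (hg : IsHtpyEquiv g) (hf : IsHtpyEquiv f) :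
    IsHtpyEquiv (g.comp f) := by
  obtain ⟨f', hf₁, hf₂⟩ := hf
  obtain ⟨g', hg₁, hg₂⟩ := hg
  let e := ContinuousMap.HomotopyEquiv.trans ⟨f, f', hf₁, hf₂⟩ ⟨g, g', hg₁, hg₂⟩
  exact ⟨e.invFun, e.left_inv, e.right_inv⟩

theorem joined_of_homotopic {X Y : Type*} [TopologicalSpace X] [TopologicalSpace Y] {f g : C(X, Y)}
    (h : f.Homotopic g) (x : X) : Joined (f x) (g x) := by
  obtain ⟨H⟩ := h
  exact ⟨H.evalAt x⟩

theorem Joined.mapContinuous {X Y : Type*} [TopologicalSpace X] [TopologicalSpace Y] {x y : X}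
    (h : Joined x y) (f : C(X, Y)) : Joined (f x) (f y) := by
  obtain ⟨p⟩ := h
  exact ⟨p.map f.continuous⟩

namespace WedgeOfSpheres

variable {ι : Type*} {d : ι → ℕ}

theorem apply_zero_of_dim_zero {n : ℕ} (hn : n = 0) (x : USphere n) : x.1 0 = 1 ∨ x.1 0 = -1 := by
  subst hn
  have h := norm_coe_usphere x
  rw [EuclideanSpace.norm_eq, Real.sqrt_eq_one, Fin.sum_univ_one, Real.norm_eq_abs, sq_abs] at h
  exact sq_eq_one_iff.mp h

theorem ext_of_dim_zero {n : ℕ} (hn : n = 0) {x y : USphere n} (h : x.1 0 = y.1 0) : x = y := by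
  subst hn
  ext i
  rwa [Fin.fin_one_eq_zero i]

theorem joined_pt_of_dim_ne_zero {i : ι} (hd : d i ≠ 0) (x : USphere (d i)) :
    Joined (pt ι d) (sph d i x) := by
  have hr : 1 < Module.rank ℝ (EuclideanSpace ℝ (Fin (d i + 1))) := by
    rw [← Module.finrank_eq_rank, finrank_euclideanSpace_fin]
    exact_mod_cast Nat.lt_add_of_pos_left (Nat.pos_of_ne_zero hd)
  have h := (isPathConnected_sphere hr 0 zero_le_one).joinedIn _ (spherePt (d i)).2 _ x.2
  rw [← sph_spherePt i]
  exact h.joined_subtype.mapContinuous (sph d i)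

/-- A point which cannot be joined to the wedge point is alone in its path component. -/
theorem eq_of_joined {c c' : WedgeOfSpheres ι d} (h : Joined c c') (hc : ¬ Joined (pt ι d) c) :
    c' = c := by
  classical
  induction c using ind with
  | h₀ => exact absurd (Joined.refl _) hc
  | h₁ i x =>
    have hd : d i = 0 := by
      by_contra hd
      exact hc (joined_pt_of_dim_ne_zero hd x)
    have hx : x.1 0 = -1 := by
      refine (apply_zero_of_dim_zero hd x).resolve_left fun h1 => hc ?_
      have : x = spherePt (d i) := ext_of_dim_zero hd (by simp [h1, spherePt])
      rw [this, sph_spherePt]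
    let f : C(WedgeOfSpheres ι d, ℝ) :=
      desc 1 (fun j => ⟨fun y => if j = i then y.1 0 else 1, by split_ifs <;> fun_prop⟩)
        (fun j => by simp [spherePt])
    have hf : ∀ c, f c = 1 ∨ c = sph d i x := by
      intro c
      induction c using ind with
      | h₀ => exact Or.inl rfl
      | h₁ j y =>
        by_cases hj : j = i
        · subst hj
          rcases apply_zero_of_dim_zero hd y with h1 | h1
          · exact Or.inl ((if_pos rfl).trans h1)
          · exact Or.inr (by rw [ext_of_dim_zero hd (h1.trans hx.symm)])
        · exact Or.inl (if_neg hj)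
    have hfx : f (sph d i x) = -1 := (if_pos rfl).trans hx
    have hU : IsClopen (f ⁻¹' Set.Iio 0) := by
      refine ⟨?_, isOpen_Iio.preimage f.continuous⟩
      have : f ⁻¹' Set.Iio 0 = f ⁻¹' {-1} := by
        ext c
        rcases hf c with h1 | rfl
        · simp only [Set.mem_preimage, Set.mem_Iio, Set.mem_singleton_iff, h1]
          norm_num
        · simp only [Set.mem_preimage, Set.mem_Iio, Set.mem_singleton_iff, hfx]
          norm_num
      rw [this]
      exact isClosed_singleton.preimage f.continuous
    have hmem := hU.connectedComponent_subset (x := sph d i x) (by simp [hfx])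
      (pathComponent_subset_component _ h)
    refine (hf c').resolve_left fun h1 => ?_
    rw [Set.mem_preimage, h1, Set.mem_Iio] at hmem
    linarith

end WedgeOfSpheres

section Swap

variable {X Z : Type*} [TopologicalSpace X] [TopologicalSpace Z] {b : X}

open Classical in
/-- Changing the value of a continuous map at an isolated point. -/
noncomputable def updateAt (hb : IsClopen {b}) (z : Z) (f : C(X, Z)) : C(X, Z) :=
  ⟨fun y => if y = b then z else f y, Continuous.if (by
    intro y hy
    rw [show {y | y = b} = ({b} : Set X) from rfl, hb.frontier_eq] at hy
    exact hy.elim) continuous_const f.continuous⟩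

theorem updateAt_self (hb : IsClopen {b}) (z : Z) (f : C(X, Z)) : updateAt hb z f b = z :=
  if_pos rfl

theorem updateAt_of_ne (hb : IsClopen {b}) (z : Z) (f : C(X, Z)) {y : X} (hy : y ≠ b) :
    updateAt hb z f y = f y := if_neg hy

theorem updateAt_homotopic (hb : IsClopen {b}) (z : Z) {f g : C(X, Z)} (h : f.Homotopic g) :
    (updateAt hb z f).Homotopic (updateAt hb z g) := by
  classical
  obtain ⟨H⟩ := h
  refine ⟨⟨⟨fun p => if p.2 = b then z else H p, Continuous.if ?_ continuous_const
    H.continuous⟩, fun y => ?_, fun y => ?_⟩⟩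
  · intro p hp
    have : IsClopen {p : unitInterval × X | p.2 = b} := hb.preimage continuous_snd
    rw [this.frontier_eq] at hp
    exact hp.elim
  · change (if y = b then z else H (0, y)) = if y = b then z else f y
    rw [H.apply_zero]
  · change (if y = b then z else H (1, y)) = if y = b then z else g y
    rw [H.apply_one]

/-- If all points but at most one isolated point can be joined to `x`, then a homotopy equivalence
with a wedge of spheres can be chosen to map `x` to the path component of the wedge point. -/
theorem IsHtpyEquiv.exists_joined_pt {ι : Type*} {d : ι → ℕ} {g : C(X, WedgeOfSpheres ι d)}
    (hg : IsHtpyEquiv g) {x : X}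
    (h : (∀ y, Joined x y) ∨ ∃ b, b ≠ x ∧ IsClopen {b} ∧ ∀ y, y ≠ b → Joined x y) :
    ∃ k : C(X, WedgeOfSpheres ι d), IsHtpyEquiv k ∧ Joined (k x) (WedgeOfSpheres.pt ι d) := by
  by_cases hx : Joined (WedgeOfSpheres.pt ι d) (g x)
  · exact ⟨g, hg, hx.symm⟩
  have hg' := hg
  obtain ⟨k, h₁, h₂⟩ := hg'
  have hk : Joined (g (k (WedgeOfSpheres.pt ι d))) (WedgeOfSpheres.pt ι d) :=
    joined_of_homotopic h₂ _
  have hnj : ¬ Joined x (k (WedgeOfSpheres.pt ι d)) := fun hj =>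
    hx (hk.symm.trans (hj.mapContinuous g).symm)
  rcases h with h | ⟨b, hbx, hb, h⟩
  · exact absurd (h _) hnj
  have hkb : k (WedgeOfSpheres.pt ι d) = b := by
    by_contra hne
    exact hnj (h _ hne)
  let s : C(X, X) := updateAt hb x (ContinuousMap.const X b)
  have hs : (s.comp s).Homotopic (ContinuousMap.id X) := by
    have e₀ : s.comp s = updateAt hb b (ContinuousMap.const X x) := by
      ext y
      by_cases hy : y = b
      · subst hy
        change s (s y) = _
        rw [updateAt_self, updateAt_self, updateAt_of_ne _ _ _ hbx.symm]
        rfl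
      · change s (s y) = _
        rw [updateAt_of_ne _ _ _ hy, updateAt_of_ne _ _ _ hy]
        exact updateAt_self _ _ _
    have e₁ : ContinuousMap.id X = updateAt hb b (ContinuousMap.id X) := by
      ext y
      by_cases hy : y = b
      · subst hy
        exact (updateAt_self _ _ _).symm
      · exact (updateAt_of_ne _ _ _ hy).symm
    have e₂ : updateAt hb b (k.comp g) = updateAt hb b (ContinuousMap.const X (k (g x))) := by
      ext y
      by_cases hy : y = b
      · subst hy
        rw [updateAt_self, updateAt_self]
      · rw [updateAt_of_ne _ _ _ hy, updateAt_of_ne _ _ _ hy]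
        exact congrArg k (WedgeOfSpheres.eq_of_joined ((h y hy).mapContinuous g) hx)
    obtain ⟨p⟩ : Joined (k (g x)) x := joined_of_homotopic h₁ x
    have h₃ : (ContinuousMap.const X (k (g x))).Homotopic (ContinuousMap.const X x) :=
      ⟨⟨⟨fun q => p q.1, by fun_prop⟩, fun _ => p.source, fun _ => p.target⟩⟩
    rw [e₀, e₁]
    exact ((updateAt_homotopic hb b h₁.symm).trans
      (e₂ ▸ updateAt_homotopic hb b h₃)).symm
  refine ⟨g.comp s, hg.comp ⟨s, hs, hs⟩, ?_⟩
  have hsx : s x = b := updateAt_of_ne _ _ _ hbx.symm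
  change Joined (g (s x)) _
  rwa [hsx, ← hkb]

end Swap

/-- The mapping cone of a constant map between spaces homotopy equivalent to wedges of spheres. -/
theorem MCone.nonempty_homotopyEquiv_wedgeOfSpheres {L D κ₁ κ₂ : Type*} [TopologicalSpace L]
    [TopologicalSpace D] {d₁ : κ₁ → ℕ} {d₂ : κ₂ → ℕ} {f : C(D, WedgeOfSpheres κ₁ d₁)}
    (hf : IsHtpyEquiv f) {g : C(L, WedgeOfSpheres κ₂ d₂)} (hg : IsHtpyEquiv g) (x : D)
    (h : (∃ k : C(D, WedgeOfSpheres κ₁ d₁), IsHtpyEquiv k ∧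
      Joined (k x) (WedgeOfSpheres.pt κ₁ d₁)) ∨ Subsingleton L) :
    Nonempty (ContinuousMap.HomotopyEquiv (MCone (fun _ : L => x))
      (WedgeOfSpheres (κ₁ ⊕ κ₂) (Sum.elim d₁ (fun j => d₂ j + 1)))) := by
  obtain ⟨ec⟩ := (WedgeOfSpheres.isHtpyEquiv_collapse d₁ d₂).nonempty
  obtain ⟨ep⟩ := (MCone.isHtpyEquiv_pull (WedgeOfSpheres.pt κ₁ d₁) hg).nonempty
  rcases h with ⟨k, hk, hj⟩ | hL
  · obtain ⟨e₁⟩ := (MCone.isHtpyEquiv_push (ContinuousMap.const L x) hk).nonempty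
    obtain ⟨e₂⟩ := MCone.nonempty_homotopyEquiv_of_joined (L := L) hj
    exact ⟨((e₁.trans e₂).trans ep).trans ec⟩
  · have hne : Nonempty L := by
      obtain ⟨k, -, -⟩ := hg
      exact ⟨k (WedgeOfSpheres.pt κ₂ d₂)⟩
    obtain ⟨e₀⟩ := (MCone.isHtpyEquiv_incl_of_subsingleton (L := L) x).nonempty
    obtain ⟨e₁⟩ := hf.nonempty
    obtain ⟨e₂⟩ := (MCone.isHtpyEquiv_incl_of_subsingleton (L := L)
      (WedgeOfSpheres.pt κ₁ d₁)).nonempty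
    exact ⟨(((e₀.symm.trans e₁).trans e₂).trans ep).trans ec⟩

/-! ### Connectivity of realizations -/

section Connectivity

variable {α : Type*} [Fintype α] {K : Set (Finset α)}

/-- A map into a realization is homotopic to a constant map if each of its values shares a face
with a fixed point. -/
theorem nonempty_homotopy_const {X : Type*} [TopologicalSpace X] (φ : C(X, realization K))
    (p : realization K)
    (h : ∀ x, ∃ σ ∈ K, (φ x).1 ∈ realization {σ} ∧ p.1 ∈ realization {σ}) :
    Nonempty (φ.Homotopy (ContinuousMap.const X p)) := by
  refine ⟨⟨⟨fun q => ⟨(1 - q.1.1) • (φ q.2).1 + q.1.1 • p.1, ?_⟩, ?_⟩, fun x => ?_, fun x => ?_⟩⟩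
  · obtain ⟨σ, hσ, hx, hp⟩ := h q.2
    exact realization_singleton_subset hσ (convex_realization_singleton σ hx hp
      (sub_nonneg.mpr q.1.2.2) q.1.2.1 (sub_add_cancel _ _))
  · fun_prop
  · exact Subtype.ext (by simp)
  · exact Subtype.ext (by simp)

theorem mem_realization_singleton_of_mem {x : α → ℝ} (hx : x ∈ realization K) :
    ∃ σ ∈ K, x ∈ realization {σ} := by
  obtain ⟨h₀, h₁, σ, hσ, h⟩ := hx
  exact ⟨σ, hσ, h₀, h₁, σ, rfl, h⟩

variable [DecidableEq α]

theorem eq_single_of_support {x : α → ℝ} (hx : x ∈ realization K) {a : α}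
    (h : ∀ b, x b ≠ 0 → b = a) : x = Pi.single a 1 := by
  have h0 : ∀ b, b ≠ a → x b = 0 := fun b hb => not_imp_comm.mp (h b) hb
  have h1 := hx.2.1
  rw [sum_eq_single a (fun b _ hb => h0 b hb) (fun h => absurd (mem_univ a) h)] at h1
  funext b
  by_cases hb : b = a
  · subst hb; simp [h1]
  · simp [hb, h0 b hb]

theorem joined_vertexPt_of_apply_ne_zero (hK : IsLowerSet K) {y : realization K} {a : α}
    (ha : y.1 a ≠ 0) : ∃ h : {a} ∈ K, Joined (vertexPt h) y := by
  obtain ⟨σ, hσ, hy⟩ := mem_realization_singleton_of_mem y.2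
  have has : a ∈ σ := by
    obtain ⟨-, -, _, rfl, h⟩ := hy
    exact h a ha
  exact ⟨hK (singleton_subset_iff.mpr has) hσ,
    joined_of_mem_realization_singleton hσ (single_mem_realization_singleton has) hy⟩

theorem joined_vertexPt {a b : α} (ha : {a} ∈ K) (hb : {b} ∈ K) (hab : {a, b} ∈ K) :
    Joined (vertexPt ha) (vertexPt hb) :=
  joined_of_mem_realization_singleton hab
    (single_mem_realization_singleton (mem_insert_self a {b}))
    (single_mem_realization_singleton (mem_insert_of_mem (mem_singleton_self b)))

/-- If at most one vertex of a complex is not in the path component of the vertex `c`, then the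
realization is path connected or the union of a path connected set and an isolated point. -/
theorem joined_or_exists_isClopen_singleton (hK : IsLowerSet K) {c : α} (hc : {c} ∈ K)
    (h : ∀ a b (ha : {a} ∈ K) (hb : {b} ∈ K), ¬ Joined (vertexPt hc) (vertexPt ha) →
      ¬ Joined (vertexPt hc) (vertexPt hb) → a = b) :
    (∀ y, Joined (vertexPt hc) y) ∨
      ∃ p, p ≠ vertexPt hc ∧ IsClopen {p} ∧ ∀ y, y ≠ p → Joined (vertexPt hc) y := by
  by_cases hb : ∃ b, ∃ hb : {b} ∈ K, ¬ Joined (vertexPt hc) (vertexPt hb)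
  · right
    obtain ⟨b, hb, hcb⟩ := hb
    have key : ∀ y, y ≠ vertexPt hb → Joined (vertexPt hc) y := by
      intro y hy
      obtain ⟨a, hay, hab⟩ : ∃ a, y.1 a ≠ 0 ∧ a ≠ b := by
        by_contra! h'
        exact hy (Subtype.ext (eq_single_of_support y.2 h'))
      obtain ⟨ha, hj⟩ := joined_vertexPt_of_apply_ne_zero hK hay
      refine Joined.trans ?_ hj
      by_contra hca
      exact hab (h a b ha hb hca hcb)
    refine ⟨vertexPt hb, fun h' => hcb (h' ▸ Joined.refl _), ⟨isClosed_singleton, ?_⟩, key⟩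
    have hset : ({vertexPt hb} : Set (realization K)) = {y | y.1 b ≠ 0} := by
      ext y
      refine ⟨?_, fun hy => ?_⟩
      · rintro rfl
        simp [vertexPt]
      · by_contra hne
        obtain ⟨_, hj⟩ := joined_vertexPt_of_apply_ne_zero hK hy
        exact hcb ((key y hne).trans hj.symm)
    rw [hset]
    exact isOpen_ne_fun ((continuous_apply b).comp continuous_subtype_val) continuous_const
  · left
    push Not at hb
    intro y
    obtain ⟨a, ha⟩ : ∃ a, y.1 a ≠ 0 := by
      by_contra! h'
      have := y.2.2.1
      simp [h'] at this
    obtain ⟨ha', hj⟩ := joined_vertexPt_of_apply_ne_zero hK ha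
    exact (hb a ha').trans hj

theorem subsingleton_realization_of_insert_mem {D : Set (Finset α)} {c : α} (hD : IsLowerSet D) (hKD : ∀ τ ∈ K, insert c τ ∈ D)
    (h : ∀ a, a ≠ c → {c, a} ∉ D) : Subsingleton (realization K) := by
  have key : ∀ y : realization K, y.1 = Pi.single c 1 := by
    intro y
    refine eq_single_of_support y.2 fun b hb => ?_
    obtain ⟨-, -, τ, hτ, hy⟩ := y.2
    by_contra hbc
    refine h b hbc (hD ?_ (hKD τ hτ))
    exact insert_subset_insert c (singleton_subset_iff.mpr (hy b hb))
  exact ⟨fun y z => Subtype.ext ((key y).trans (key z).symm)⟩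

end Connectivity

/-! ### Bounded degree complexes -/

section BoundedDegree

variable {V : Type*} [DecidableEq V] {G : SimpleGraph V} {lam : V → ℕ}

theorem edgeDeg_mono {H H' : Finset (Sym2 V)} (h : H ⊆ H') (x : V) :
    edgeDeg H x ≤ edgeDeg H' x :=
  card_le_card (filter_subset_filter _ h)

theorem edgeDeg_insert {H : Finset (Sym2 V)} {e : Sym2 V} (he : e ∉ H) (x : V) :
    edgeDeg (insert e H) x = edgeDeg H x + if x ∈ e then 1 else 0 := by
  unfold edgeDeg
  rw [filter_insert]
  split_ifs
  · exact card_insert_of_notMem fun h => he (mem_filter.mp h).1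
  · rfl

theorem edgeDeg_singleton (e : Sym2 V) (x : V) :
    edgeDeg {e} x = if x ∈ e then 1 else 0 := by
  rw [← insert_empty_eq, edgeDeg_insert (notMem_empty e)]
  simp [edgeDeg]

theorem isLowerSet_BD : IsLowerSet (BD G lam) := fun _ _ h ⟨h₁, h₂⟩ =>
  ⟨(coe_subset.mpr h).trans h₁, fun x => (edgeDeg_mono h x).trans (h₂ x)⟩

theorem empty_mem_BD : ∅ ∈ BD G lam := by
  simp [BD, edgeDeg]

theorem isLowerSet_delC {α : Type*} [DecidableEq α] {K : Set (Finset α)} (hK : IsLowerSet K)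
    (a : α) : IsLowerSet (delC K a) := fun _ _ h ⟨h₁, h₂⟩ =>
  ⟨hK h h₁, fun h' => h₂ (h h')⟩

theorem singleton_mem_BD {x y : V} (h : G.Adj x y) (hx : 1 ≤ lam x) (hy : 1 ≤ lam y) :
    {s(x, y)} ∈ BD G lam := by
  refine ⟨by simpa using h, fun z => ?_⟩
  rw [edgeDeg_singleton]
  split_ifs with hz
  · rcases Sym2.mem_iff.mp hz with rfl | rfl <;> assumption
  · exact Nat.zero_le _

theorem delC_BD (e : Sym2 V) : delC (BD G lam) e = BD (G.deleteEdges {e}) lam := by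
  ext τ
  simp only [delC, BD, Set.mem_ofPred_eq, SimpleGraph.edgeSet_deleteEdges, Set.subset_sdiff,
    Set.disjoint_singleton_right, mem_coe]
  tauto

theorem linkC_BD {v w : V} (hvw : G.Adj v w) (hv : 1 ≤ lam v) (hw : 1 ≤ lam w) :
    linkC (BD G lam) s(v, w) = BD (G.deleteEdges {s(v, w)})
      (fun x => if x = v ∨ x = w then lam x - 1 else lam x) := by
  have key : ∀ x n, (n ≤ if x = v ∨ x = w then lam x - 1 else lam x) ↔
      n + (if x ∈ s(v, w) then 1 else 0) ≤ lam x := by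
    intro x n
    simp only [Sym2.mem_iff]
    split_ifs with h
    · have : 1 ≤ lam x := by rcases h with rfl | rfl <;> assumption
      omega
    · rfl
  rw [← delC_BD]
  ext τ
  simp only [linkC, delC, BD, Set.mem_ofPred_eq, key, coe_insert, Set.insert_subset_iff,
    SimpleGraph.mem_edgeSet]
  constructor
  · rintro ⟨⟨h₁, -⟩, h₂, -, h₃⟩
    simp only [edgeDeg_insert h₂] at h₃
    exact ⟨⟨h₁, h₃⟩, h₂⟩
  · rintro ⟨⟨h₁, h₃⟩, h₂⟩
    simp only [edgeDeg_insert h₂]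
    exact ⟨⟨h₁, fun x => (Nat.le_add_right _ _).trans (h₃ x)⟩, h₂, ⟨hvw, h₁⟩, h₃⟩

theorem exists_mem_of_pair_notMem_BD {a b : Sym2 V} (ha : {a} ∈ BD G lam) (hb : {b} ∈ BD G lam)
    (hne : a ≠ b) (h : {a, b} ∉ BD G lam) : ∃ z, z ∈ a ∧ z ∈ b ∧ lam z < 2 := by
  by_contra! hz
  refine h ⟨?_, fun z => ?_⟩
  · rw [coe_insert, Set.insert_subset_iff]
    exact ⟨ha.1 (by simp), hb.1⟩
  · have ha' := ha.2 z
    have hb' := hb.2 z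
    have hz' := hz z
    rw [edgeDeg_singleton] at ha' hb'
    rw [edgeDeg_insert (by simpa using hne), edgeDeg_singleton]
    split_ifs at * <;> simp_all

end BoundedDegree

/-! ### The recursion at an edge next to a leaf -/

section Recursion

variable {V : Type*} {G : SimpleGraph V} {u v w : V}

theorem eq_of_mem_edgeSet_of_neighborSet_eq (hu : G.neighborSet u = {v}) {e : Sym2 V}
    (he : e ∈ G.edgeSet) (h : u ∈ e) : e = s(u, v) := by
  obtain ⟨x, rfl⟩ := h
  have hx : x ∈ G.neighborSet u := he
  rw [hu] at hx
  rw [Set.mem_singleton_iff.mp hx]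

theorem adj_of_neighborSet_eq (hu : G.neighborSet u = {v}) : G.Adj u v := by
  rw [← SimpleGraph.mem_neighborSet, hu]
  rfl

theorem edge_ne_leaf_edge (hu : G.neighborSet u = {v}) (huw : u ≠ w) : s(u, v) ≠ s(v, w) := by
  intro h
  rcases Sym2.mem_iff.mp (h ▸ Sym2.mem_mk_left u v : u ∈ s(v, w)) with h' | h'
  exacts [(adj_of_neighborSet_eq hu).ne h', huw h']

theorem neighborSet_deleteEdges (hu : G.neighborSet u = {v}) (huw : u ≠ w) :
    (G.deleteEdges {s(v, w)}).neighborSet u = {v} := by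
  ext x
  have hx : G.Adj u x ↔ x = v := by
    rw [← SimpleGraph.mem_neighborSet, hu, Set.mem_singleton_iff]
  rw [SimpleGraph.mem_neighborSet, SimpleGraph.deleteEdges_adj, hx, Set.mem_singleton_iff,
    Set.mem_singleton_iff, and_iff_left_iff_imp]
  rintro rfl
  exact edge_ne_leaf_edge hu huw

variable [DecidableEq V] {lam : V → ℕ}

theorem insert_mem_delC_BD (hu : G.neighborSet u = {v}) (huw : u ≠ w)
    (hlu : 1 ≤ lam u) {τ : Finset (Sym2 V)} (hτ : τ ∈ linkC (BD G lam) s(v, w)) :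
    insert s(u, v) τ ∈ delC (BD G lam) s(v, w) := by
  obtain ⟨hτ₁, hτ₂, hτ₃⟩ := hτ
  by_cases hf : s(u, v) ∈ τ
  · rw [insert_eq_of_mem hf]
    exact ⟨hτ₁, hτ₂⟩
  refine ⟨⟨?_, fun x => ?_⟩, ?_⟩
  · rw [coe_insert, Set.insert_subset_iff]
    exact ⟨adj_of_neighborSet_eq hu, hτ₁.1⟩
  · rw [edgeDeg_insert hf]
    have h₁ := hτ₁.2 x
    have h₃ := hτ₃.2 x
    rw [edgeDeg_insert hτ₂] at h₃
    split_ifs with hx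
    · rcases Sym2.mem_iff.mp hx with rfl | rfl
      · have h0 : edgeDeg τ x = 0 := by
          rw [edgeDeg, card_eq_zero, filter_eq_empty_iff]
          intro d hd hxd
          exact hf (eq_of_mem_edgeSet_of_neighborSet_eq hu (hτ₁.1 hd) hxd ▸ hd)
        omega
      · simpa using h₃
    · exact h₁
  · rw [mem_insert, not_or]
    exact ⟨(edge_ne_leaf_edge hu huw).symm, hτ₂⟩

/-- In a forest, at most one vertex of the complex lies outside the path component of a leaf edge
`s(u, v)` that shares a face with another edge. -/
theorem eq_of_not_joined_leaf_edge [Fintype V] (hG : G.IsAcyclic)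
    (hu : G.neighborSet u = {v}) (hf : {s(u, v)} ∈ BD G lam) {a : Sym2 V} (haf : a ≠ s(u, v))
    (ha : {s(u, v), a} ∈ BD G lam) {b c : Sym2 V} (hb : {b} ∈ BD G lam) (hc : {c} ∈ BD G lam)
    (hb' : ¬ Joined (vertexPt hf) (vertexPt hb)) (hc' : ¬ Joined (vertexPt hf) (vertexPt hc)) :
    b = c := by
  have ha₁ : {a} ∈ BD G lam := isLowerSet_BD (by simp) ha
  have key : ∀ {b : Sym2 V} (hb : {b} ∈ BD G lam), ¬ Joined (vertexPt hf) (vertexPt hb) →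
      lam v < 2 ∧ ∃ z, z ∈ a ∧ b = s(v, z) ∧ z ≠ v := by
    intro b hb hj
    have hbG : b ∈ G.edgeSet := hb.1 (by simp)
    have hfb : s(u, v) ≠ b := by
      rintro rfl
      exact hj (Joined.refl _)
    obtain ⟨z, hzf, hzb, hz⟩ := exists_mem_of_pair_notMem_BD hf hb hfb fun h =>
      hj (joined_vertexPt hf hb h)
    have hzv : z = v := by
      rcases Sym2.mem_iff.mp hzf with rfl | rfl
      · exact absurd (eq_of_mem_edgeSet_of_neighborSet_eq hu hbG hzb).symm hfb
      · rfl
    subst hzv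
    have hza : z ∉ a := by
      intro hza
      have h2 := ha.2 z
      rw [edgeDeg_insert (by simpa using haf.symm), edgeDeg_singleton, if_pos hza,
        if_pos hzf] at h2
      omega
    have hab : a ≠ b := by
      rintro rfl
      exact hza hzb
    obtain ⟨y, hya, hyb, -⟩ := exists_mem_of_pair_notMem_BD ha₁ hb hab fun h =>
      hj ((joined_vertexPt hf ha₁ ha).trans (joined_vertexPt ha₁ hb h))
    have hyz : y ≠ z := by
      rintro rfl
      exact hza hya
    exact ⟨hz, y, hya, (Sym2.mem_and_mem_iff hyz.symm).mp ⟨hzb, hyb⟩, hyz⟩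
  obtain ⟨-, y, hya, rfl, hy⟩ := key hb hb'
  obtain ⟨-, z, hza, rfl, hz⟩ := key hc hc'
  by_contra hne
  have hyz : y ≠ z := by
    rintro rfl
    exact hne rfl
  have haG : a ∈ G.edgeSet := ha₁.1 (by simp)
  rw [(Sym2.mem_and_mem_iff hyz).mp ⟨hya, hza⟩] at haG
  have hvy : s(v, y) ∈ G.edgeSet := hb.1 (by simp)
  have hvz : s(v, z) ∈ G.edgeSet := hc.1 (by simp)
  exact hG.cliqueFree le_rfl {v, y, z} (SimpleGraph.is3Clique_triple_iff.mpr ⟨hvy, hvz, haG⟩)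

end Recursion

end

/-- for a forest `G` with an edge `e = {v,w}` having a leaf `u ∉ e` adjacent to
the endpoint `v`, the complex `BD^λ(G)` is homotopy equivalent to the wedge of `BD^λ(G \ e)`
with the suspension of `BD^{λ_e}(G \ e)`; consequently, if `BD^λ(G \ e)` is a wedge of `n₁`
spheres of dimensions `d₁` and `BD^{λ_e}(G \ e)` a wedge of `n₂` spheres of dimensions `d₂`,
then `BD^λ(G)` is a wedge of `n₁ + n₂` spheres of dimensions `d₁` together with `d₂ + 1`
(so the number of `d`-spheres satisfies `(F,λ)_d = (F\e,λ)_d + (F\e,λ_e)_{d-1}`). -/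
theorem BD_forest_recursion {V : Type*} [Fintype V] [DecidableEq V]
    (G : SimpleGraph V) (hG : G.IsAcyclic) (lam : V → ℕ)
    (v w u : V) (hvw : G.Adj v w) (hu : G.neighborSet u = {v}) (huw : u ≠ w)
    (hlv : 1 ≤ lam v) (hlw : 1 ≤ lam w) (hlu : 1 ≤ lam u)
    (n₁ n₂ : ℕ) (d₁ : Fin n₁ → ℕ) (d₂ : Fin n₂ → ℕ)
    (h₁ : Nonempty (ContinuousMap.HomotopyEquiv
      (realization (BD (G.deleteEdges {s(v, w)}) lam)) (WedgeOfSpheres (Fin n₁) d₁)))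
    (h₂ : Nonempty (ContinuousMap.HomotopyEquiv
      (realization (BD (G.deleteEdges {s(v, w)})
        (fun x => if x = v ∨ x = w then lam x - 1 else lam x)))
      (WedgeOfSpheres (Fin n₂) d₂))) :
    (∃ (x₀ : realization (BD (G.deleteEdges {s(v, w)}) lam))
        (y₀ : realization (suspC (BD (G.deleteEdges {s(v, w)})
          (fun x => if x = v ∨ x = w then lam x - 1 else lam x)))),
      Nonempty (ContinuousMap.HomotopyEquiv (realization (BD G lam))
        (wedgeTwo (realization (BD (G.deleteEdges {s(v, w)}) lam))
          (realization (suspC (BD (G.deleteEdges {s(v, w)})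
            (fun x => if x = v ∨ x = w then lam x - 1 else lam x)))) x₀ y₀))) ∧
    Nonempty (ContinuousMap.HomotopyEquiv (realization (BD G lam))
      (WedgeOfSpheres (Fin n₁ ⊕ Fin n₂) (Sum.elim d₁ (fun j => d₂ j + 1)))) := by
  have hf : {s(u, v)} ∈ delC (BD G lam) s(v, w) :=
    ⟨singleton_mem_BD (adj_of_neighborSet_eq hu) hlu hlv, by
      simpa using (edge_ne_leaf_edge hu huw).symm⟩
  have hins := fun τ hτ => insert_mem_delC_BD (lam := lam) hu huw hlu (τ := τ) hτ
  have hlow := isLowerSet_delC (isLowerSet_BD (G := G) (lam := lam)) s(v, w)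
  have hL : ∅ ∈ linkC (BD G lam) s(v, w) := by
    rw [linkC_BD hvw hlv hlw]
    exact empty_mem_BD
  have hcases : (∃ a, a ≠ s(u, v) ∧ {s(u, v), a} ∈ delC (BD G lam) s(v, w)) →
      ∀ b c (hb : {b} ∈ delC (BD G lam) s(v, w)) (hc : {c} ∈ delC (BD G lam) s(v, w)),
        ¬ Joined (vertexPt hf) (vertexPt hb) → ¬ Joined (vertexPt hf) (vertexPt hc) → b = c := by
    revert hf
    rw [delC_BD]
    intro hf ⟨a, haf, ha⟩ b c hb hc
    exact eq_of_not_joined_leaf_edge (hG.anti (SimpleGraph.deleteEdges_le _))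
      (neighborSet_deleteEdges hu huw) hf haf ha hb hc
  rw [← delC_BD] at h₁ ⊢
  rw [← linkC_BD hvw hlv hlw] at h₂ ⊢
  obtain ⟨N⟩ := nonempty_homotopy_const (linkIncl (BD G lam) s(v, w)) (vertexPt hf) fun y => by
    obtain ⟨τ, hτ, hy₀, hy₁, _, rfl, hy⟩ := mem_realization_singleton_of_mem y.2
    exact ⟨_, hins _ hτ, ⟨hy₀, hy₁, _, rfl, fun a ha => mem_insert_of_mem (hy a ha)⟩,
      single_mem_realization_singleton (mem_insert_self _ _)⟩
  obtain ⟨k, hk₁, hk₂⟩ := MCone.isHtpyEquiv_transfer N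
  let E : ContinuousMap.HomotopyEquiv (realization (BD G lam))
      (MCone (ContinuousMap.const (realization (linkC (BD G lam) s(v, w))) (vertexPt hf))) :=
    (coneHomeomorph isLowerSet_BD (singleton_mem_BD hvw hlv hlw)).symm.toHomotopyEquiv.trans
      (ContinuousMap.HomotopyEquiv.symm ⟨_, k, hk₁, hk₂⟩)
  refine ⟨⟨vertexPt hf, vertexPt (inr_zero_mem_suspC hL),
    ⟨E.trans (wedgeHomeomorph hL (vertexPt hf)).toHomotopyEquiv⟩⟩, ?_⟩
  obtain ⟨f⟩ := h₁
  obtain ⟨g⟩ := h₂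
  have hf' : IsHtpyEquiv f.toFun := ⟨f.invFun, f.left_inv, f.right_inv⟩
  have hg' : IsHtpyEquiv g.toFun := ⟨g.invFun, g.left_inv, g.right_inv⟩
  obtain ⟨E'⟩ := MCone.nonempty_homotopyEquiv_wedgeOfSpheres hf' hg' (vertexPt hf) <| by
    by_cases hP : ∃ a, a ≠ s(u, v) ∧ {s(u, v), a} ∈ delC (BD G lam) s(v, w)
    · exact Or.inl (hf'.exists_joined_pt
        (joined_or_exists_isClopen_singleton hlow hf (hcases hP)))
    · push Not at hP
      exact Or.inr (subsingleton_realization_of_insert_mem hlow hins hP)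
  exact ⟨E.trans E'⟩
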